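/- arXiv:1011.4617 — 7 statements merged into one kernel-verified Lean document; each statement's English description precedes it below -/
import Mathlib

section
/- Let X be a Polish metric space and (P_n)_{n∈ℕ} Borel probability measures on X. Assume that for every δ > 0 there exists a sequence (K_n) of Borel subsets of X such that P_n(K_n) ≥ 1 − δ for every n, and such that every sequence (x_n) with x_n ∈ K_n for all n has the property that each of its subsequences admits a further convergent subsequence (the K_n are not assumed compact). Then (P_n) admits a subsequence which converges weakly to a Borel probability measure P on X. -/
open MeasureTheory Filter

/-- A set of measures on a Polish space is tight as soon as, along every increasing open cover,
the masses of the complements become small uniformly over the set. -/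
theorem isTightMeasureSet_of_forall_monotone_open_cover {X : Type*} [TopologicalSpace X]
    [PolishSpace X] [MeasurableSpace X] {S : Set (Measure X)}
    (hS : ∀ U : ℕ → Set X, (∀ i, IsOpen (U i)) → Monotone U → ⋃ i, U i = Set.univ →
      ∀ ε : ENNReal, 0 < ε → ∃ k, ∀ μ ∈ S, μ (U k)ᶜ ≤ ε) :
    IsTightMeasureSet S := by
  let := TopologicalSpace.upgradeIsCompletelyMetrizable X
  rw [isTightMeasureSet_iff_exists_isCompact_measure_compl_le]
  intro ε hε
  rcases isEmpty_or_nonempty X with hX | hX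
  · exact ⟨∅, isCompact_empty, fun μ _ => by simp [Set.eq_empty_of_isEmpty]⟩
  obtain ⟨D, hD⟩ := TopologicalSpace.exists_dense_seq X
  obtain ⟨η, hη, hsum⟩ := ENNReal.exists_pos_sum_of_countable' hε.ne' ℕ
  have hpos (m : ℕ) : (0 : ℝ) < 1 / (m + 1) := Nat.one_div_pos_of_nat
  have hcover (m : ℕ) :
      ∃ k, ∀ μ ∈ S, μ (⋃ i ≤ k, Metric.ball (D i) (1 / (m + 1)))ᶜ ≤ η m := by
    refine hS (fun k => ⋃ i ≤ k, Metric.ball (D i) (1 / (m + 1)))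
      (fun k => isOpen_biUnion fun i _ => Metric.isOpen_ball)
      (fun a b hab => Set.biUnion_mono (fun i hi => le_trans hi hab) fun _ _ => le_rfl)
      (Set.eq_univ_of_forall fun x => ?_) (η m) (hη m)
    obtain ⟨i, hi⟩ := Metric.denseRange_iff.1 hD x _ (hpos m)
    exact Set.mem_iUnion.2 ⟨i, Set.mem_biUnion (le_refl i) hi⟩
  choose k hk using hcover
  refine ⟨⋂ m, ⋃ i ≤ k m, Metric.closedBall (D i) (1 / (m + 1)), ?_, fun μ hμ => ?_⟩
  · refine TotallyBounded.isCompact_of_isClosed (Metric.totallyBounded_iff.2 fun δ hδ => ?_)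
      (isClosed_iInter fun m =>
        (Set.finite_Iic (k m)).isClosed_biUnion fun i _ => Metric.isClosed_closedBall)
    obtain ⟨m, hm⟩ := exists_nat_one_div_lt hδ
    refine ⟨D '' Set.Iic (k m), (Set.finite_Iic _).image _, ?_⟩
    rw [Set.biUnion_image]
    exact (Set.iInter_subset _ m).trans
      (Set.biUnion_mono subset_rfl fun i _ => Metric.closedBall_subset_ball hm)
  · rw [Set.compl_iInter]
    refine (measure_iUnion_le _).trans ((ENNReal.tsum_le_tsum fun m => ?_).trans hsum.le)
    refine (measure_mono (Set.compl_subset_compl.2 ?_)).trans (hk m μ hμ)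
    exact Set.biUnion_mono subset_rfl fun i _ => Metric.ball_subset_closedBall

/-- If every selection of points from the nonempty sets `K n` is relatively sequentially compact
along subsequences, then some member of an increasing open cover contains all but finitely many
of the `K n`. -/
theorem exists_eventually_subset_of_forall_subseq_tendsto {X : Type*} [TopologicalSpace X]
    {K : ℕ → Set X} (hne : ∀ n, (K n).Nonempty)
    (hK : ∀ x : ℕ → X, (∀ n, x n ∈ K n) → ∀ φ : ℕ → ℕ, StrictMono φ →
      ∃ ψ : ℕ → ℕ, StrictMono ψ ∧ ∃ y : X, Tendsto (fun n => x (φ (ψ n))) atTop (nhds y))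
    {U : ℕ → Set X} (hU : ∀ i, IsOpen (U i)) (hmono : Monotone U)
    (hcover : ⋃ i, U i = Set.univ) :
    ∃ m, ∀ᶠ n in atTop, K n ⊆ U m := by
  by_contra! hcon
  obtain ⟨φ, hφ, hφU⟩ := extraction_forall_of_frequently hcon
  have hsel (n : ℕ) : ∃ x ∈ K n, ∀ j, φ j = n → x ∉ U j := by
    by_cases hn : ∃ j, φ j = n
    · obtain ⟨j, rfl⟩ := hn
      obtain ⟨x, hx, hxU⟩ := Set.not_subset.1 (hφU j)
      exact ⟨x, hx, fun i hi => hφ.injective hi ▸ hxU⟩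
    · obtain ⟨x, hx⟩ := hne n
      exact ⟨x, hx, fun j hj => (hn ⟨j, hj⟩).elim⟩
  choose x hxK hxU using hsel
  obtain ⟨ψ, hψ, y, hy⟩ := hK x hxK φ hφ
  obtain ⟨i, hi⟩ := Set.mem_iUnion.1 (hcover.symm ▸ Set.mem_univ y)
  obtain ⟨n, hn, hin⟩ :=
    ((hy.eventually ((hU i).mem_nhds hi)).and (eventually_ge_atTop i)).exists
  exact hxU (φ (ψ n)) (ψ n) rfl (hmono (hin.trans hψ.le_apply) hn)

/-- Along an increasing measurable cover, finitely many finite measures simultaneously have small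
mass outside a member of the cover. -/
theorem eventually_forall_lt_measure_compl_le {X : Type*} [MeasurableSpace X]
    (P : ℕ → Measure X) [∀ n, IsFiniteMeasure (P n)]
    {U : ℕ → Set X} (hU : ∀ i, MeasurableSet (U i)) (hmono : Monotone U)
    (hcover : ⋃ i, U i = Set.univ) {ε : ENNReal} (hε : 0 < ε) (N : ℕ) :
    ∀ᶠ k in atTop, ∀ n < N, P n (U k)ᶜ ≤ ε := by
  refine (Set.finite_Iio N).eventually_all.2 fun n _ => ?_
  have hlim := tendsto_measure_iInter_atTop (μ := P n) (s := fun k => (U k)ᶜ)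
    (fun k => (hU k).compl.nullMeasurableSet)
    (fun a b hab => Set.compl_subset_compl.2 (hmono hab)) ⟨0, measure_ne_top _ _⟩
  rw [← Set.compl_iUnion, hcover, Set.compl_univ, measure_empty] at hlim
  exact hlim.eventually_le_const hε

/-- Lemma 2.1 (E. Lesigne): a tightness-type criterion. If Borel probability measures `P n`
on a Polish space put mass `≥ 1 - δ` on sets `K n` such that any sequence of points chosen
from the `K n` is sequentially compact (any subsequence has a further convergent subsequence),
then `P n` has a weakly convergent subsequence. -/
theorem stmt1 {X : Type*} [MetricSpace X] [PolishSpace X] [MeasurableSpace X] [BorelSpace X]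
    (P : ℕ → Measure X) (hP : ∀ n, IsProbabilityMeasure (P n))
    (h : ∀ δ : ℝ, 0 < δ → ∃ K : ℕ → Set X,
      (∀ n, MeasurableSet (K n)) ∧
      (∀ n, ENNReal.ofReal (1 - δ) ≤ P n (K n)) ∧
      (∀ x : ℕ → X, (∀ n, x n ∈ K n) → ∀ φ : ℕ → ℕ, StrictMono φ →
        ∃ ψ : ℕ → ℕ, StrictMono ψ ∧ ∃ y : X,
          Tendsto (fun n => x (φ (ψ n))) atTop (nhds y))) :
    ∃ φ : ℕ → ℕ, StrictMono φ ∧ ∃ Q : Measure X, IsProbabilityMeasure Q ∧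
      ∀ g : BoundedContinuousFunction X ℝ,
        Tendsto (fun n => ∫ a, g a ∂(P (φ n))) atTop (nhds (∫ a, g a ∂Q)) := by
  have htight : IsTightMeasureSet (Set.range P) := by
    refine isTightMeasureSet_of_forall_monotone_open_cover fun U hU hmono hcover ε hε => ?_
    obtain ⟨δ, hδ, hδ1, hδε⟩ : ∃ δ : ℝ, 0 < δ ∧ δ < 1 ∧ ENNReal.ofReal δ ≤ ε := by
      obtain ⟨r, hr, hrε⟩ := ENNReal.lt_iff_exists_nnreal_btwn.1 hε
      refine ⟨min r (1 / 2), lt_min (by exact_mod_cast hr) (by norm_num),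
        (min_le_right _ _).trans_lt (by norm_num), ?_⟩
      refine (ENNReal.ofReal_le_ofReal (min_le_left _ _)).trans ?_
      simpa using hrε.le
    obtain ⟨K, hKmeas, hKP, hK⟩ := h δ hδ
    have hne (n : ℕ) : (K n).Nonempty :=
      nonempty_of_measure_ne_zero
        ((ENNReal.ofReal_pos.2 (sub_pos.2 hδ1)).trans_le (hKP n)).ne'
    obtain ⟨m, hm⟩ := exists_eventually_subset_of_forall_subseq_tendsto hne hK hU hmono hcover
    obtain ⟨N, hN⟩ := eventually_atTop.1 hm
    obtain ⟨k, hkN, hmk⟩ := ((eventually_forall_lt_measure_compl_le P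
      (fun i => (hU i).measurableSet) hmono hcover hε N).and (eventually_ge_atTop m)).exists
    refine ⟨k, Set.forall_mem_range.2 fun n => ?_⟩
    rcases lt_or_ge n N with hn | hn
    · exact hkN n hn
    · calc P n (U k)ᶜ ≤ P n (K n)ᶜ :=
            measure_mono (Set.compl_subset_compl.2 ((hN n hn).trans (hmono hmk)))
        _ = 1 - P n (K n) := prob_compl_eq_one_sub (hKmeas n)
        _ ≤ 1 - ENNReal.ofReal (1 - δ) := tsub_le_tsub_left (hKP n) 1
        _ = ENNReal.ofReal δ := by
            rw [← ENNReal.ofReal_one, ← ENNReal.ofReal_sub _ (sub_pos.2 hδ1).le, sub_sub_cancel]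
        _ ≤ ε := hδε
  let p : ℕ → ProbabilityMeasure X := fun n => ⟨P n, hP n⟩
  have hcompact : IsCompact (closure (Set.range p)) := by
    refine isCompact_closure_of_isTightMeasureSet (htight.subset ?_)
    rintro _ ⟨_, ⟨n, rfl⟩, rfl⟩
    exact ⟨n, rfl⟩
  obtain ⟨Q, -, φ, hφ, hQ⟩ :=
    hcompact.isSeqCompact fun n => subset_closure (Set.mem_range_self (f := p) n)
  exact ⟨φ, hφ, Q, Q.prop, ProbabilityMeasure.tendsto_iff_forall_integral_tendsto.1 hQ⟩
end

section
/- Let X be a Polish metric space, let (P_n) and P be Borel probability measures on X with P_n converging weakly to P, and let f_n, f : X → [0,∞] be Borel measurable functions such that whenever x_n → x in X one has liminf_{n→∞} f_n(x_n) ≥ f(x). Then liminf_{n→∞} ∫_X f_n dP_n ≥ ∫_X f dP. -/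
open MeasureTheory Filter

open scoped Topology in
/-- A pointwise lower bound along every sequence converging to `y` is a lower bound near `y`, jointly
in the index and the point. -/
theorem eventually_lt_prod_nhds_of_forall_le_liminf {X α : Type*} [TopologicalSpace X]
    [FirstCountableTopology X] [CompleteLinearOrder α] {f : ℕ → X → α} {y : X} {a t : α}
    (hlb : ∀ x : ℕ → X, Tendsto x atTop (𝓝 y) → a ≤ liminf (fun n => f n (x n)) atTop)
    (ht : t < a) : ∀ᶠ p in atTop ×ˢ 𝓝 y, t < f p.1 p.2 := by
  by_contra h
  obtain ⟨p, hp, hpt⟩ := exists_seq_forall_of_frequently (not_eventually.1 h)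
  obtain ⟨φ, hφ, hmono⟩ := strictMono_subseq_of_tendsto_atTop (tendsto_fst.comp hp)
  set m : ℕ → ℕ := (Prod.fst ∘ p) ∘ φ
  set x : ℕ → X := Function.extend m (fun k => (p (φ k)).2) fun _ => y
  have hxm (k : ℕ) : x (m k) = (p (φ k)).2 := hmono.injective.extend_apply _ _ k
  have hx : Tendsto x atTop (𝓝 y) := by
    intro V hV
    have hsnd : Tendsto (fun k => (p (φ k)).2) atTop (𝓝 y) :=
      (tendsto_snd.comp hp).comp hφ.tendsto_atTop
    obtain ⟨K, hK⟩ := eventually_atTop.1 (hsnd.eventually_mem hV)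
    refine eventually_atTop.2 ⟨m K, fun n hn => ?_⟩
    by_cases hmem : ∃ k, m k = n
    · obtain ⟨k, rfl⟩ := hmem
      rw [hxm]
      exact hK k (hmono.le_iff_le.1 hn)
    · simpa only [x, Function.extend_apply' _ _ _ hmem] using mem_of_mem_nhds hV
  have hfreq : ∃ᶠ n in atTop, f n (x n) ≤ t := by
    refine hmono.tendsto_atTop.frequently (Frequently.of_forall fun k => ?_)
    rw [hxm]
    exact not_lt.1 (hpt (φ k))
  exact ((hlb x hx).trans (liminf_le_of_frequently_le' hfreq)).not_gt ht

/-- The layer cake formula for functions with values in `[0, ∞]`. -/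
theorem lintegral_eq_lintegral_meas_ofReal_lt {α : Type*} [MeasurableSpace α] (μ : Measure α)
    [SFinite μ] {f : α → ENNReal} (hf : Measurable f) :
    ∫⁻ a, f a ∂μ = ∫⁻ t in Set.Ioi (0 : ℝ), μ {a | ENNReal.ofReal t < f a} := by
  have hS : MeasurableSet {p : α × ℝ | ENNReal.ofReal p.2 < f p.1} :=
    measurableSet_lt (by fun_prop) (by fun_prop)
  calc
    ∫⁻ a, f a ∂μ = ∫⁻ a, volume.restrict (Set.Ioi (0 : ℝ)) {t | ENNReal.ofReal t < f a} ∂μ := by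
      refine lintegral_congr fun a => ?_
      rw [Measure.restrict_apply (measurableSet_lt (by fun_prop) measurable_const)]
      rcases eq_or_ne (f a) ⊤ with ha | ha
      · simp [ha]
      · have : {t | ENNReal.ofReal t < f a} ∩ Set.Ioi (0 : ℝ) = Set.Ioo 0 (f a).toReal := by
          ext t
          simp only [Set.mem_inter_iff, Set.mem_ofPred_eq, Set.mem_Ioi, Set.mem_Ioo]
          constructor
          · exact fun ⟨h, h0⟩ => ⟨h0, (ENNReal.ofReal_lt_iff_lt_toReal h0.le ha).1 h⟩
          · exact fun ⟨h0, h⟩ => ⟨(ENNReal.ofReal_lt_iff_lt_toReal h0.le ha).2 h, h0⟩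
        rw [this, Real.volume_Ioo, sub_zero, ENNReal.ofReal_toReal ha]
    _ = (μ.prod (volume.restrict (Set.Ioi 0))) {p : α × ℝ | ENNReal.ofReal p.2 < f p.1} :=
      (Measure.prod_apply hS).symm
    _ = _ := Measure.prod_apply_symm hS

open scoped Topology in
theorem measure_lt_le_liminf_measure_lt {X α : Type*} [TopologicalSpace X]
    [FirstCountableTopology X] [HasOuterApproxClosed X] [MeasurableSpace X] [BorelSpace X]
    [CompleteLinearOrder α] {P : ℕ → ProbabilityMeasure X} {Q : ProbabilityMeasure X}
    (hPQ : Tendsto P atTop (𝓝 Q)) {f : ℕ → X → α} {g : X → α}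
    (hlb : ∀ (x : ℕ → X) (y : X), Tendsto x atTop (𝓝 y) →
      g y ≤ liminf (fun n => f n (x n)) atTop) (t : α) :
    (Q : Measure X) {a | t < g a} ≤
      liminf (fun n => (P n : Measure X) {a | t < f n a}) atTop := by
  set U : ℕ → Set X := fun N => interior {x | ∀ n ≥ N, t < f n x}
  have hU : Monotone U := fun M N hMN =>
    interior_mono fun x hx n hn => hx n (hMN.trans hn)
  have hsub : {a | t < g a} ⊆ ⋃ N, U N := by
    intro y hy
    obtain ⟨p, hp, q, hq, hpq⟩ := eventually_prod_iff.1
      (eventually_lt_prod_nhds_of_forall_le_liminf (fun x hx => hlb x y hx) hy)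
    obtain ⟨N, hN⟩ := eventually_atTop.1 hp
    refine Set.mem_iUnion.2 ⟨N, mem_interior_iff_mem_nhds.2 ?_⟩
    filter_upwards [hq] with x hx n hn using hpq (hN n hn) hx
  calc
    (Q : Measure X) {a | t < g a} ≤ (Q : Measure X) (⋃ N, U N) := measure_mono hsub
    _ = ⨆ N, (Q : Measure X) (U N) := hU.measure_iUnion
    _ ≤ _ := iSup_le fun N =>
      (ProbabilityMeasure.le_liminf_measure_open_of_tendsto hPQ isOpen_interior).trans <|
        liminf_le_liminf <| (eventually_ge_atTop N).mono fun n hn =>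
          measure_mono fun _ hx => interior_subset hx n hn

/-- Lemma 2.2: if `P n ⇀ Q` weakly and `f n` Γ-liminf-converges to `g` (all nonnegative,
possibly infinite valued), then `liminf ∫ f n dP n ≥ ∫ g dQ`. -/
theorem stmt2 {X : Type*} [MetricSpace X] [PolishSpace X] [MeasurableSpace X] [BorelSpace X]
    (P : ℕ → Measure X) (Q : Measure X)
    (hP : ∀ n, IsProbabilityMeasure (P n)) (hQ : IsProbabilityMeasure Q)
    (hPQ : ∀ g : BoundedContinuousFunction X ℝ,
      Tendsto (fun n => ∫ a, g a ∂(P n)) atTop (nhds (∫ a, g a ∂Q)))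
    (f : ℕ → X → ENNReal) (g : X → ENNReal)
    (hf : ∀ n, Measurable (f n)) (hg : Measurable g)
    (hlb : ∀ (x : ℕ → X) (y : X), Tendsto x atTop (nhds y) →
      g y ≤ liminf (fun n => f n (x n)) atTop) :
    ∫⁻ a, g a ∂Q ≤ liminf (fun n => ∫⁻ a, f n a ∂(P n)) atTop := by
  let P' (n : ℕ) : ProbabilityMeasure X := ⟨P n, hP n⟩
  let Q' : ProbabilityMeasure X := ⟨Q, hQ⟩
  have hlim : Tendsto P' atTop (nhds Q') :=
    ProbabilityMeasure.tendsto_iff_forall_integral_tendsto.2 hPQ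
  have hmeas (n : ℕ) : Measurable fun t : ℝ => P n {a | ENNReal.ofReal t < f n a} :=
    Antitone.measurable fun s t hst =>
      measure_mono fun _ ha => (ENNReal.ofReal_le_ofReal hst).trans_lt ha
  simp_rw [lintegral_eq_lintegral_meas_ofReal_lt Q hg,
    fun n => lintegral_eq_lintegral_meas_ofReal_lt (P n) (hf n)]
  exact (lintegral_mono fun t => measure_lt_le_liminf_measure_lt hlim hlb _).trans
    (lintegral_liminf_le hmeas)
end

section
/- Let X be a Polish metric space, let (P_n) and P be Borel probability measures on X with P_n converging weakly to P, and let f_n, f : X → [0,∞] be Borel measurable functions such that whenever x_n → x in X one has liminf_{n→∞} f_n(x_n) ≥ f(x). Then for every λ > 0 and every δ > 0, liminf_{n→∞} P_n({x : f_n(x) > λ − δ}) ≥ P({x : f(x) > λ}). -/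
open MeasureTheory Filter

/-- A sequential lower bound on `liminf f n (x n)` upgrades to a bound that is uniform over a
neighbourhood and over all large indices. -/
theorem eventually_prod_nhds_lt_of_le_liminf {X Y : Type*} [TopologicalSpace X]
    [FirstCountableTopology X] [CompleteLinearOrder Y] {f : ℕ → X → Y} {a c : Y} {y : X}
    (h : ∀ x : ℕ → X, Tendsto x atTop (nhds y) → a ≤ liminf (fun n => f n (x n)) atTop)
    (hc : c < a) : ∀ᶠ p : ℕ × X in atTop ×ˢ nhds y, c < f p.1 p.2 := by
  by_contra hcon
  obtain ⟨p, hp, hpc⟩ := exists_seq_forall_of_frequently (not_eventually.1 hcon)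
  obtain ⟨hp₁, hp₂⟩ := tendsto_prod_iff'.1 hp
  obtain ⟨φ, hφ, hpφ⟩ := strictMono_subseq_of_tendsto_atTop hp₁
  set m : ℕ → ℕ := fun k => (p (φ k)).1
  have hm : StrictMono m := hpφ
  have hy : Tendsto (fun k => (p (φ k)).2) atTop (nhds y) := hp₂.comp hφ.tendsto_atTop
  set x : ℕ → X := Function.extend m (fun k => (p (φ k)).2) fun _ => y
  have hxm (k : ℕ) : x (m k) = (p (φ k)).2 := hm.injective.extend_apply _ _ k
  have hx : Tendsto x atTop (nhds y) := by
    intro U hU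
    obtain ⟨K, hK⟩ := eventually_atTop.1 (hy.eventually_mem hU)
    rw [mem_map]
    filter_upwards [eventually_ge_atTop (m K)] with n hn
    by_cases hnm : ∃ k, m k = n
    · obtain ⟨k, rfl⟩ := hnm
      simpa [hxm] using hK k (hm.le_iff_le.1 hn)
    · simpa [x, Function.extend_apply' _ _ _ hnm] using mem_of_mem_nhds hU
  have hev : ∀ᶠ n in atTop, c < f n (x n) := eventually_lt_of_lt_liminf (hc.trans_le (h x hx))
  obtain ⟨k, hk⟩ := (hm.tendsto_atTop.eventually hev).exists
  rw [hxm] at hk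
  exact hpc (φ k) hk

/-- Claim (2.4) in the proof of Lemma 2.2: under weak convergence `P n ⇀ Q` and the
Γ-liminf property of `f n` towards `g`, for every `λ > 0` and `δ > 0` one has
`liminf_n P n {f n > λ - δ} ≥ Q {g > λ}`. -/
theorem stmt3 {X : Type*} [MetricSpace X] [PolishSpace X] [MeasurableSpace X] [BorelSpace X]
    (P : ℕ → Measure X) (Q : Measure X)
    (hP : ∀ n, IsProbabilityMeasure (P n)) (hQ : IsProbabilityMeasure Q)
    (hPQ : ∀ g : BoundedContinuousFunction X ℝ,
      Tendsto (fun n => ∫ a, g a ∂(P n)) atTop (nhds (∫ a, g a ∂Q)))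
    (f : ℕ → X → ENNReal) (g : X → ENNReal)
    (hf : ∀ n, Measurable (f n)) (hg : Measurable g)
    (hlb : ∀ (x : ℕ → X) (y : X), Tendsto x atTop (nhds y) →
      g y ≤ liminf (fun n => f n (x n)) atTop) :
    ∀ lam δ : ℝ, 0 < lam → 0 < δ →
      Q {x | ENNReal.ofReal lam < g x} ≤
        liminf (fun n => P n {x | ENNReal.ofReal (lam - δ) < f n x}) atTop := by
  intro lam δ hlam hδ
  set c := ENNReal.ofReal (lam - δ)
  have hc : c < ENNReal.ofReal lam := (ENNReal.ofReal_lt_ofReal_iff hlam).2 (by linarith)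
  let U : ℕ → Set X := fun k => interior {x | ∀ n ≥ k, c < f n x}
  have hU : Monotone U := fun i j hij =>
    interior_mono fun x hx n hn => hx n (hij.trans hn)
  have hsub : {x | ENNReal.ofReal lam < g x} ⊆ ⋃ k, U k := by
    intro y hy
    obtain ⟨p, hp, q, hq, hpq⟩ := eventually_prod_iff.1
      (eventually_prod_nhds_lt_of_le_liminf (fun x hx => hlb x y hx) (hc.trans hy))
    obtain ⟨k, hk⟩ := eventually_atTop.1 hp
    refine Set.mem_iUnion.2 ⟨k, mem_interior_iff_mem_nhds.2 ?_⟩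
    filter_upwards [hq] with x hx n hn using hpq (hk n hn) hx
  let P' : ℕ → ProbabilityMeasure X := fun n => ⟨P n, hP n⟩
  have hlim : Tendsto P' atTop (nhds ⟨Q, hQ⟩) :=
    ProbabilityMeasure.tendsto_iff_forall_integral_tendsto.2 hPQ
  calc Q {x | ENNReal.ofReal lam < g x} ≤ Q (⋃ k, U k) := measure_mono hsub
    _ = ⨆ k, Q (U k) := hU.measure_iUnion
    _ ≤ _ := iSup_le fun k => by
      refine (ProbabilityMeasure.le_liminf_measure_open_of_tendsto hlim
        (isOpen_interior : IsOpen (U k))).trans (liminf_le_liminf ?_)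
      filter_upwards [eventually_ge_atTop k] with n hn
      exact measure_mono fun x hx => interior_subset hx n hn
end

section
/- Let X be a Polish metric space, n ≥ 1, and let θ : ℝⁿ × X → X satisfy θ(0,u) = u and θ(λ+μ,u) = θ(λ, θ(μ,u)) for all λ, μ ∈ ℝⁿ and u ∈ X, with θ(λ,·) : X → X continuous for every λ. Let (ω_k)_{k∈ℕ} be bounded measurable subsets of ℝⁿ of positive finite Lebesgue measure such that for every R > 0 the ratio |{x ∈ ω_k : dist(x, ℝⁿ∖ω_k) > R}| / |ω_k| → 1 as k → ∞. Let (u_k) be a sequence in X such that λ ↦ θ(λ, u_k) is Borel measurable for each k, and let P_k be the push-forward of the normalized Lebesgue measure on ω_k under λ ↦ θ(λ, u_k). If P_k converges weakly to a Borel probability measure P on X, then P is invariant under θ: for every λ₀ ∈ ℝⁿ, the push-forward of P under θ(λ₀,·) equals P. -/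
open MeasureTheory Filter Metric

/-- A bounded function changes its integral over `s` by at most `C * μ (s \ t)` when `s` is
replaced by a subset `t`. -/
theorem abs_setIntegral_sub_setIntegral_le {E : Type*} [MeasurableSpace E] {μ : Measure E}
    {f : E → ℝ} (hf : Measurable f) {C : ℝ} (hC : ∀ x, |f x| ≤ C) {s t : Set E}
    (hs : μ s < ⊤) (ht : MeasurableSet t) (hts : t ⊆ s) :
    |∫ x in s, f x ∂μ - ∫ x in t, f x ∂μ| ≤ C * (μ.real s - μ.real t) := by
  have hint : IntegrableOn f s μ :=
    Measure.integrableOn_of_bounded hs.ne hf.aestronglyMeasurable (M := C)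
      (Eventually.of_forall hC)
  rw [← setIntegral_sdiff ht hint hts, ← measureReal_sdiff hts ht hs.ne]
  exact norm_setIntegral_le_of_norm_le_const (f := f) (C := C)
    ((measure_mono Set.sdiff_subset).trans_lt hs) fun x _ => (Real.norm_eq_abs _).trans_le (hC x)

/-- Translating a bounded integrand by `v` changes its integral over `s` by at most
`2 * C * μ (s \ t)`, if both `t` and its translate by `v` lie in `s`. -/
theorem abs_setIntegral_comp_add_left_sub_le {E : Type*} [MeasurableSpace E] [AddGroup E]
    [MeasurableAdd E] {μ : Measure E} [μ.IsAddLeftInvariant]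
    {f : E → ℝ} (hf : Measurable f) {C : ℝ} (hC : ∀ x, |f x| ≤ C) {s t : Set E}
    (hs : μ s < ⊤) (ht : MeasurableSet t) (hts : t ⊆ s) (v : E) (hv : ∀ x ∈ t, v + x ∈ s) :
    |∫ x in s, f (v + x) ∂μ - ∫ x in s, f x ∂μ| ≤ 2 * C * (μ.real s - μ.real t) := by
  have hpres : MeasurePreserving (MeasurableEquiv.addLeft v) μ μ :=
    measurePreserving_add_left μ v
  set t' : Set E := MeasurableEquiv.addLeft v '' t
  have ht' : MeasurableSet t' := (MeasurableEquiv.addLeft v).measurableSet_image.2 ht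
  have hts' : t' ⊆ s := by
    rintro _ ⟨x, hx, rfl⟩
    exact hv x hx
  have hint : ∫ x in t', f x ∂μ = ∫ x in t, f (v + x) ∂μ :=
    hpres.setIntegral_image_emb (MeasurableEquiv.addLeft v).measurableEmbedding f t
  have hμ : μ.real t' = μ.real t := by
    have h := hpres.measure_preimage_equiv t'
    rw [Set.preimage_image_eq _ (MeasurableEquiv.addLeft v).injective] at h
    simp only [Measure.real, h]
  have h1 := abs_setIntegral_sub_setIntegral_le (hf.comp (measurable_const_add v))
    (fun x => hC (v + x)) hs ht hts
  have h2 := abs_setIntegral_sub_setIntegral_le hf hC hs ht' hts'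
  rw [hint, hμ] at h2
  simp only [Function.comp_apply] at h1
  rw [abs_le] at *
  constructor <;> linarith

/-- Step 2 of the proof of Theorem 3: the weak limit `P` of the push-forwards of the
normalized Lebesgue measures on `ω k` under `λ ↦ θ λ (u k)` is invariant under the
action `θ`. -/
theorem stmt4
    {X : Type*} [MetricSpace X] [PolishSpace X] [MeasurableSpace X] [BorelSpace X]
    {n : ℕ} (hn : 1 ≤ n)
    (θ : EuclideanSpace ℝ (Fin n) → X → X)
    (hθ0 : ∀ u : X, θ 0 u = u)
    (hθadd : ∀ (lam mu : EuclideanSpace ℝ (Fin n)) (u : X),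
      θ (lam + mu) u = θ lam (θ mu u))
    (hθcont : ∀ lam, Continuous (θ lam))
    (ω : ℕ → Set (EuclideanSpace ℝ (Fin n)))
    (hωmeas : ∀ k, MeasurableSet (ω k))
    (hωbdd : ∀ k, Bornology.IsBounded (ω k))
    (hωpos : ∀ k, 0 < volume (ω k))
    (hωfin : ∀ k, volume (ω k) < ⊤)
    (hωratio : ∀ R : ℝ, 0 < R →
      Tendsto (fun k => (volume {x | x ∈ ω k ∧ R < infDist x (ω k)ᶜ}).toReal
        / (volume (ω k)).toReal) atTop (nhds 1))
    (u : ℕ → X)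
    (humeas : ∀ k, Measurable (fun lam => θ lam (u k)))
    (P : Measure X) (hP : IsProbabilityMeasure P)
    (hconv : ∀ g : BoundedContinuousFunction X ℝ,
      Tendsto (fun k => ∫ x, g x ∂(Measure.map (fun lam => θ lam (u k))
        ((volume (ω k))⁻¹ • volume.restrict (ω k)))) atTop (nhds (∫ x, g x ∂P))) :
    ∀ lam, Measure.map (θ lam) P = P := by
  intro v
  have hmap : IsProbabilityMeasure (Measure.map (θ v) P) :=
    Measure.isProbabilityMeasure_map (hθcont v).measurable.aemeasurable
  refine ext_of_forall_integral_eq_of_IsFiniteMeasure fun g => ?_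
  rw [integral_map (hθcont v).measurable.aemeasurable g.continuous.aestronglyMeasurable]
  set gv : BoundedContinuousFunction X ℝ := g.compContinuous ⟨θ v, hθcont v⟩
  have havg : ∀ (h : BoundedContinuousFunction X ℝ) (k : ℕ),
      ∫ x, h x ∂(Measure.map (fun lam => θ lam (u k))
        ((volume (ω k))⁻¹ • volume.restrict (ω k)))
      = (volume.real (ω k))⁻¹ * ∫ lam in ω k, h (θ lam (u k)) := by
    intro h k
    rw [integral_map (humeas k).aemeasurable h.continuous.aestronglyMeasurable,
      integral_smul_measure, ENNReal.toReal_inv, smul_eq_mul, Measure.real]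
  have hlim := (hconv gv).sub (hconv g)
  have hzero : Tendsto (fun k => ∫ x, gv x ∂(Measure.map (fun lam => θ lam (u k))
        ((volume (ω k))⁻¹ • volume.restrict (ω k))) -
      ∫ x, g x ∂(Measure.map (fun lam => θ lam (u k))
        ((volume (ω k))⁻¹ • volume.restrict (ω k)))) atTop (nhds 0) := by
    have hratio := ((hωratio (‖v‖ + 1) (by positivity)).const_sub 1).const_mul (2 * ‖g‖)
    rw [sub_self, mul_zero] at hratio
    refine squeeze_zero_norm (fun k => ?_) hratio
    have hpos : 0 < volume.real (ω k) := ENNReal.toReal_pos (hωpos k).ne' (hωfin k).ne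
    have hbound := abs_setIntegral_comp_add_left_sub_le (μ := volume)
      (g.continuous.measurable.comp (humeas k)) (fun lam => g.norm_coe_le_norm _) (hωfin k)
      (t := {x | x ∈ ω k ∧ ‖v‖ + 1 < infDist x (ω k)ᶜ})
      ((hωmeas k).inter (measurableSet_lt measurable_const measurable_infDist))
      (fun x hx => hx.1) v (fun x hx => by
        by_contra hmem
        have h := infDist_le_dist_of_mem (x := x) (s := (ω k)ᶜ) hmem
        rw [dist_comm, dist_eq_norm, add_sub_cancel_right] at h
        linarith [hx.2])
    have hgv : ∀ lam, gv (θ lam (u k)) = g (θ (v + lam) (u k)) := fun lam => by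
      rw [hθadd]; rfl
    simp only [havg, hgv, ← mul_sub, Real.norm_eq_abs, abs_mul, abs_inv, abs_of_pos hpos]
    rw [inv_mul_le_iff₀ hpos]
    refine hbound.trans_eq ?_
    simp only [Measure.real] at hpos ⊢
    field_simp
  exact sub_eq_zero.1 (tendsto_nhds_unique hlim hzero)
end

section
/- Let Λ = ℤv₁ ⊕ ℤv₂ ⊂ ℝ² be a lattice generated by two linearly independent vectors v₁, v₂, and let c = |det(v₁, v₂)| > 0 be its covolume. For n ∈ ℕ, n ≥ 1, set w(n) = Σ_{p ∈ Λ∖{0}} e^{−|p|²/(2n²)}/(4π²|p|²) − (1/c) ∫_{ℝ²} e^{−|y|²/(2n²)}/(1 + 4π²|y|²) dy, and for x > 0 set v(x) = Σ_{p ∈ Λ∖{0}} 1/(4π²|p|^{2+x}) − (1/c) ∫_{ℝ²} 1/(1 + 4π²|y|^{2+x}) dy. Then the limit lim_{n→∞} w(n) exists in ℝ, the limit lim_{x→0⁺} v(x) exists in ℝ, and the two limits are equal. -/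
open MeasureTheory Filter

/-- The linear map `(s, t) ↦ s v₁ + t v₂`. -/
noncomputable def pairMap (v₁ v₂ : EuclideanSpace ℝ (Fin 2)) :
    ℝ × ℝ →ₗ[ℝ] EuclideanSpace ℝ (Fin 2) :=
  (LinearMap.toSpanSingleton ℝ _ v₁).coprod (LinearMap.toSpanSingleton ℝ _ v₂)

theorem pairMap_apply (v₁ v₂ : EuclideanSpace ℝ (Fin 2)) (z : ℝ × ℝ) :
    pairMap v₁ v₂ z = z.1 • v₁ + z.2 • v₂ := rfl

theorem continuous_pairMap (v₁ v₂ : EuclideanSpace ℝ (Fin 2)) : Continuous (pairMap v₁ v₂) :=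
  LinearMap.continuous_of_finiteDimensional _

theorem det_ne_zero_of_linearIndependent {v₁ v₂ : EuclideanSpace ℝ (Fin 2)}
    (hind : LinearIndependent ℝ ![v₁, v₂]) : v₁ 0 * v₂ 1 - v₁ 1 * v₂ 0 ≠ 0 := by
  intro hd
  rw [LinearIndependent.pair_iff] at hind
  obtain ⟨-, h₁⟩ := hind (v₂ 1) (-v₁ 1) (by
    ext i; fin_cases i <;> simp <;> linarith)
  obtain ⟨-, h₀⟩ := hind (v₂ 0) (-v₁ 0) (by
    ext i; fin_cases i <;> simp <;> linarith)
  have := (hind 1 0 (by ext i; fin_cases i <;> simp <;> linarith)).1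
  exact one_ne_zero this

theorem exists_norm_le_mul_norm_pairMap {v₁ v₂ : EuclideanSpace ℝ (Fin 2)}
    (hind : LinearIndependent ℝ ![v₁, v₂]) :
    ∃ κ > 0, ∀ z, κ * ‖z‖ ≤ ‖pairMap v₁ v₂ z‖ := by
  obtain ⟨K, hK, h⟩ := (pairMap v₁ v₂).exists_antilipschitzWith (by
    rw [LinearMap.ker_eq_bot']
    intro z hz
    obtain ⟨h₁, h₂⟩ := LinearIndependent.pair_iff.1 hind z.1 z.2 hz
    exact Prod.ext h₁ h₂)
  have hK' : (0 : ℝ) < K := hK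
  refine ⟨(K : ℝ)⁻¹, by positivity, fun z => ?_⟩
  have := h.le_mul_dist z 0
  rw [map_zero, dist_zero_right, dist_zero_right] at this
  rwa [inv_mul_le_iff₀ hK']

theorem map_pairMap_volume {v₁ v₂ : EuclideanSpace ℝ (Fin 2)}
    (hd : v₁ 0 * v₂ 1 - v₁ 1 * v₂ 0 ≠ 0) :
    Measure.map (pairMap v₁ v₂) volume =
      ENNReal.ofReal |(v₁ 0 * v₂ 1 - v₁ 1 * v₂ 0)⁻¹| • volume := by
  let b := (EuclideanSpace.basisFun (Fin 2) ℝ).toBasis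
  let L := Matrix.toLin b b !![v₁ 0, v₂ 0; v₁ 1, v₂ 1]
  have hL : LinearMap.det L = v₁ 0 * v₂ 1 - v₁ 1 * v₂ 0 := by
    rw [LinearMap.det_toLin, Matrix.det_fin_two_of]; ring
  have he : MeasurePreserving (fun z : ℝ × ℝ => (WithLp.toLp 2 ![z.1, z.2] :
      EuclideanSpace ℝ (Fin 2))) :=
    (PiLp.volume_preserving_toLp (Fin 2)).comp (volume_preserving_finTwoArrow ℝ).symm
  have hcomp : (pairMap v₁ v₂ : ℝ × ℝ → EuclideanSpace ℝ (Fin 2)) =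
      L ∘ fun z : ℝ × ℝ => (WithLp.toLp 2 ![z.1, z.2] : EuclideanSpace ℝ (Fin 2)) := by
    funext z
    have h (w) : L w = w 0 • v₁ + w 1 • v₂ := by
      have : w = w 0 • b 0 + w 1 • b 1 := by
        ext i; fin_cases i <;> simp [b]
      conv_lhs => rw [this]
      simp only [L, map_add, map_smul, Matrix.toLin_self]
      ext i; fin_cases i <;> simp [b]
    simp [h, pairMap_apply]
  rw [hcomp, ← Measure.map_map (LinearMap.continuous_of_finiteDimensional L).measurable
    he.measurable, he.map_eq, Measure.map_linearMap_addHaar_eq_smul_addHaar _ (hL ▸ hd), hL]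

theorem integrable_comp_pairMap {v₁ v₂ : EuclideanSpace ℝ (Fin 2)}
    (hd : v₁ 0 * v₂ 1 - v₁ 1 * v₂ 0 ≠ 0) {f : EuclideanSpace ℝ (Fin 2) → ℝ}
    (hf : Integrable f) : Integrable (fun z => f (pairMap v₁ v₂ z)) := by
  refine Integrable.comp_measurable (g := f) ?_ (continuous_pairMap v₁ v₂).measurable
  rw [map_pairMap_volume hd]
  exact hf.smul_measure ENNReal.ofReal_ne_top

theorem integral_comp_pairMap {v₁ v₂ : EuclideanSpace ℝ (Fin 2)}
    (hd : v₁ 0 * v₂ 1 - v₁ 1 * v₂ 0 ≠ 0) {f : EuclideanSpace ℝ (Fin 2) → ℝ}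
    (hf : Integrable f) :
    ∫ z, f (pairMap v₁ v₂ z) = (1 / |v₁ 0 * v₂ 1 - v₁ 1 * v₂ 0|) * ∫ y, f y := by
  rw [← integral_map (continuous_pairMap v₁ v₂).aemeasurable, map_pairMap_volume hd,
    integral_smul_measure, ENNReal.toReal_ofReal (abs_nonneg _), abs_inv, one_div, smul_eq_mul]
  rw [map_pairMap_volume hd]
  exact hf.1.smul_measure _

/-- The componentwise floor on the plane. -/
noncomputable def floorPair (z : ℝ × ℝ) : ℤ × ℤ := (⌊z.1⌋, ⌊z.2⌋)

theorem measurable_floorPair : Measurable floorPair := by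
  unfold floorPair; fun_prop

theorem volume_real_preimage_floorPair (q : ℤ × ℤ) :
    (Measure.map floorPair volume).real {q} = 1 := by
  have : floorPair ⁻¹' {q} =
      Set.Ico (q.1 : ℝ) (q.1 + 1) ×ˢ Set.Ico (q.2 : ℝ) (q.2 + 1) := by
    ext z
    simp [floorPair, Prod.ext_iff, Int.floor_eq_iff]
  rw [measureReal_def, Measure.map_apply measurable_floorPair (measurableSet_singleton q), this,
    Measure.volume_eq_prod, Measure.prod_prod]
  simp

theorem integral_comp_floorPair {g : ℤ × ℤ → ℝ} (hg : Integrable (fun z => g (floorPair z))) :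
    ∫ z, g (floorPair z) = ∑' q, g q := by
  have hg' : Integrable g (Measure.map floorPair volume) :=
    (integrable_map_measure (measurable_of_countable g).aestronglyMeasurable
      measurable_floorPair.aemeasurable).2 hg
  rw [← integral_map measurable_floorPair.aemeasurable hg'.1, integral_countable hg']
  simp [volume_real_preimage_floorPair]

theorem norm_floorPair_sub_le (v₁ v₂ : EuclideanSpace ℝ (Fin 2)) (z : ℝ × ℝ) :
    |‖pairMap v₁ v₂ ((floorPair z).1, (floorPair z).2)‖ - ‖pairMap v₁ v₂ z‖| ≤
      ‖v₁‖ + ‖v₂‖ := by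
  rw [abs_sub_comm]
  refine (abs_norm_sub_norm_le _ _).trans ?_
  have h : pairMap v₁ v₂ z - pairMap v₁ v₂ ((floorPair z).1, (floorPair z).2) =
      Int.fract z.1 • v₁ + Int.fract z.2 • v₂ := by
    rw [← map_sub, pairMap_apply]
    rfl
  have hfract (t : ℝ) (v : EuclideanSpace ℝ (Fin 2)) : ‖Int.fract t • v‖ ≤ ‖v‖ := by
    rw [norm_smul, Real.norm_of_nonneg (Int.fract_nonneg t)]
    exact mul_le_of_le_one_left (norm_nonneg v) (Int.fract_lt_one t).le
  rw [h]
  exact (norm_add_le _ _).trans (add_le_add (hfract _ _) (hfract _ _))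

theorem one_le_norm_intCast_prod {q : ℤ × ℤ} (hq : q ≠ 0) : 1 ≤ ‖((q.1 : ℝ), (q.2 : ℝ))‖ := by
  rw [Prod.norm_mk, le_max_iff, Real.norm_eq_abs, Real.norm_eq_abs]
  by_contra! h
  refine hq (Prod.ext ?_ ?_)
  · exact Int.abs_lt_one_iff.1 (by exact_mod_cast h.1)
  · exact Int.abs_lt_one_iff.1 (by exact_mod_cast h.2)

/-- Renormalized lattice sums: the sum of `a i ‖p‖` over the nonzero lattice points minus the
integral of `b i ‖y‖` divided by the covolume converges when `a i` and `b i` converge pointwise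
and are uniformly close, up to bounded shifts of the argument, to order `-3` at infinity. -/
theorem tendsto_lattice_tsum_sub_integral {ι : Type*} {F : Filter ι} [F.IsCountablyGenerated]
    {v₁ v₂ : EuclideanSpace ℝ (Fin 2)} (hind : LinearIndependent ℝ ![v₁, v₂])
    {a b : ι → ℝ → ℝ} {α β : ℝ → ℝ}
    (ha : ∀ δ > 0, ∃ M, ∀ᶠ i in F, ∀ r ≥ δ, |a i r| ≤ M)
    (hb : ∀ᶠ i in F, ∀ s ≥ 0, |b i s| ≤ 1)
    (hab : ∀ R ≥ 0, ∃ C, ∀ᶠ i in F, ∀ r s, |r - s| ≤ R → 2 * R + 2 ≤ s →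
      |a i r - b i s| ≤ C / s ^ 3)
    (hint : ∀ᶠ i in F, Integrable fun y : EuclideanSpace ℝ (Fin 2) => b i ‖y‖)
    (hα : ∀ r > 0, Tendsto (fun i => a i r) F (nhds (α r)))
    (hβ : ∀ s ≥ 0, Tendsto (fun i => b i s) F (nhds (β s))) :
    Tendsto (fun i => (∑' q : {q : ℤ × ℤ // q ≠ 0}, a i ‖pairMap v₁ v₂ (q.1.1, q.1.2)‖) -
        (1 / |v₁ 0 * v₂ 1 - v₁ 1 * v₂ 0|) * ∫ y : EuclideanSpace ℝ (Fin 2), b i ‖y‖) F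
      (nhds (∫ z, ((if floorPair z = 0 then 0 else
        α ‖pairMap v₁ v₂ ((floorPair z).1, (floorPair z).2)‖) - β ‖pairMap v₁ v₂ z‖))) := by
  have hd := det_ne_zero_of_linearIndependent hind
  obtain ⟨κ, hκ, hκz⟩ := exists_norm_le_mul_norm_pairMap hind
  have hfloor {q : ℤ × ℤ} (hq : q ≠ 0) : κ ≤ ‖pairMap v₁ v₂ (q.1, q.2)‖ :=
    (le_mul_of_one_le_right hκ.le (one_le_norm_intCast_prod hq)).trans (hκz _)
  set R := ‖v₁‖ + ‖v₂‖
  have hR0 : 0 ≤ R := by positivity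
  obtain ⟨M, hM⟩ := ha κ hκ
  obtain ⟨C, hC⟩ := hab R hR0
  set g : ι → ℤ × ℤ → ℝ := fun i q => if q = 0 then 0 else a i ‖pairMap v₁ v₂ (q.1, q.2)‖ with hg
  set D := |C| * (1 + κ⁻¹) ^ 3 + (|M| + 1) * (1 + κ⁻¹ * (2 * R + 2)) ^ 3
  have hbound : ∀ᶠ i in F, ∀ z : ℝ × ℝ,
      ‖g i (floorPair z) - b i ‖pairMap v₁ v₂ z‖‖ ≤ D * (1 + ‖z‖) ^ (-3 : ℝ) := by
    filter_upwards [hb, hM, hC] with i hbi hMi hCi z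
    have hz : (1 + ‖z‖) ^ (-3 : ℝ) = ((1 + ‖z‖) ^ 3)⁻¹ := by
      rw [Real.rpow_neg (by positivity)]; norm_cast
    have hzκ : ‖z‖ ≤ κ⁻¹ * ‖pairMap v₁ v₂ z‖ := by
      rw [le_inv_mul_iff₀ hκ]; exact hκz z
    have hnear := norm_floorPair_sub_le v₁ v₂ z
    rw [hz, ← div_eq_mul_inv, le_div_iff₀ (by positivity), Real.norm_eq_abs]
    rcases le_or_gt (2 * R + 2) ‖pairMap v₁ v₂ z‖ with hs | hs
    · have hq : floorPair z ≠ 0 := by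
        intro h
        have h0 : pairMap v₁ v₂ (((floorPair z).1 : ℝ), ((floorPair z).2 : ℝ)) = 0 := by
          rw [h]; simp [pairMap_apply]
        rw [h0, norm_zero, zero_sub, abs_neg, abs_norm] at hnear
        linarith
      have hs0 : 0 < ‖pairMap v₁ v₂ z‖ := by linarith
      have h1 := hCi _ _ hnear hs
      simp only [hg, if_neg hq]
      calc _ ≤ |C| / ‖pairMap v₁ v₂ z‖ ^ 3 * ((1 + κ⁻¹) * ‖pairMap v₁ v₂ z‖) ^ 3 := by
            gcongr
            · exact h1.trans (by gcongr; exact le_abs_self C)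
            · linarith
        _ = |C| * (1 + κ⁻¹) ^ 3 := by field_simp
        _ ≤ D := le_add_of_nonneg_right (by positivity)
    · have hgi : |g i (floorPair z)| ≤ |M| := by
        by_cases hq : floorPair z = 0
        · simp [hg, hq]
        · simp only [hg, if_neg hq]
          exact (hMi _ (hfloor hq)).trans (le_abs_self M)
      calc _ ≤ (|M| + 1) * (1 + κ⁻¹ * (2 * R + 2)) ^ 3 := by
            gcongr
            · exact (abs_sub _ _).trans (add_le_add hgi (hbi _ (norm_nonneg _)))
            · exact hzκ.trans (by gcongr)
        _ ≤ D := le_add_of_nonneg_left (by positivity)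
  have hDint : Integrable fun z : ℝ × ℝ => D * (1 + ‖z‖) ^ (-3 : ℝ) :=
    (integrable_one_add_norm (by simp; norm_num)).const_mul D
  have hmeas : ∀ᶠ i in F, AEStronglyMeasurable
      (fun z => g i (floorPair z) - b i ‖pairMap v₁ v₂ z‖) := by
    filter_upwards [hint] with i hi
    exact ((measurable_of_countable (g i)).comp measurable_floorPair).aestronglyMeasurable.sub
      (integrable_comp_pairMap hd hi).1
  refine (tendsto_integral_filter_of_dominated_convergence _ hmeas
    (hbound.mono fun i hi => ae_of_all _ hi) hDint (ae_of_all _ fun z => ?_)).congr' ?_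
  · refine Tendsto.sub ?_ (hβ _ (norm_nonneg _))
    by_cases hq : floorPair z = 0
    · simpa [hg, hq] using tendsto_const_nhds
    · simpa only [hg, if_neg hq] using hα _ (hκ.trans_le (hfloor hq))
  · filter_upwards [hmeas, hbound, hint] with i hmi hbi hi
    have hbint := integrable_comp_pairMap hd hi
    have hgint : Integrable fun z => g i (floorPair z) := by
      simpa [Pi.add_def] using (hDint.mono' hmi (ae_of_all _ hbi)).add hbint
    rw [integral_sub hgint hbint, integral_comp_floorPair hgint, integral_comp_pairMap hd hi]
    congr 1
    rw [show g i = Set.indicator {q | q ≠ 0} fun q => a i ‖pairMap v₁ v₂ (q.1, q.2)‖ by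
      funext q; by_cases hq : q = 0 <;> simp [hg, hq]]
    exact (tsum_subtype {q : ℤ × ℤ | q ≠ 0} fun q => a i ‖pairMap v₁ v₂ (q.1, q.2)‖).symm

/-- A regularizing weight on `[1, ∞)` with values in `[0, 1]`, decreasing slowly. -/
def IsSlowWeight (g : ℝ → ℝ) : Prop :=
  ∀ r s, 1 ≤ r → r ≤ s → 0 ≤ g s ∧ g s ≤ g r ∧ g r ≤ 1 ∧ g r - g s ≤ (s ^ 2 - r ^ 2) / r ^ 2

theorem isSlowWeight_gaussian {n : ℝ} (hn : 0 < n) :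
    IsSlowWeight fun r => Real.exp (-r ^ 2 / (2 * n ^ 2)) := by
  intro r s hr hrs
  have hr0 : 0 < r := by linarith
  have hsq : r ^ 2 ≤ s ^ 2 := by gcongr
  refine ⟨(Real.exp_pos _).le, ?_, ?_, ?_⟩
  · dsimp only; gcongr
  · rw [Real.exp_le_one_iff, neg_div]
    exact neg_nonpos.2 (by positivity)
  · set x := r ^ 2 / (2 * n ^ 2) with hx
    set y := s ^ 2 / (2 * n ^ 2) with hy
    have hx0 : 0 < x := by positivity
    have hxy : x ≤ y := by rw [hx, hy]; gcongr
    have hdiv : (s ^ 2 - r ^ 2) / r ^ 2 = (y - x) / x := by rw [hx, hy]; field_simp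
    simp only [neg_div, hdiv, ← hx, ← hy]
    have h₁ : Real.exp (-y) = Real.exp (-x) * Real.exp (x - y) := by
      rw [← Real.exp_add]; ring_nf
    have h₂ := Real.add_one_le_exp (x - y)
    have h₃ : Real.exp (-x) ≤ 1 / x := by
      rw [Real.exp_neg, ← one_div]
      exact one_div_le_one_div_of_le hx0 (by linarith [Real.add_one_le_exp x])
    calc Real.exp (-x) - Real.exp (-y) = Real.exp (-x) * (1 - Real.exp (x - y)) := by
          rw [h₁]; ring
      _ ≤ Real.exp (-x) * (y - x) := by
        refine mul_le_mul_of_nonneg_left ?_ (Real.exp_pos _).le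
        linarith
      _ ≤ 1 / x * (y - x) := by
        have := sub_nonneg.2 hxy
        gcongr
      _ = (y - x) / x := by ring

theorem isSlowWeight_rpow_neg {x : ℝ} (hx₀ : 0 ≤ x) (hx₁ : x ≤ 1) :
    IsSlowWeight fun r => r ^ (-x) := by
  intro r s hr hrs
  have hr0 : 0 < r := by linarith
  have hs0 : 0 < s := by linarith
  have hr1 : r ^ (-x) ≤ 1 := Real.rpow_le_one_of_one_le_of_nonpos hr (by linarith)
  refine ⟨by positivity, Real.rpow_le_rpow_of_nonpos hr0 hrs (by linarith), hr1, ?_⟩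
  have h₁ : s ^ (-x) = r ^ (-x) * (r / s) ^ x := by
    rw [Real.div_rpow hr0.le hs0.le, Real.rpow_neg hr0.le, Real.rpow_neg hs0.le]
    have := (Real.rpow_pos_of_pos hr0 x).ne'
    field_simp
  have hrs1 : r / s ≤ 1 := (div_le_one hs0).2 hrs
  have h₂ : r / s ≤ (r / s) ^ x := by
    simpa using Real.rpow_le_rpow_of_exponent_ge (by positivity) hrs1 hx₁
  calc r ^ (-x) - s ^ (-x) = r ^ (-x) * (1 - (r / s) ^ x) := by rw [h₁]; ring
    _ ≤ r ^ (-x) * (1 - r / s) := by gcongr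
    _ ≤ 1 * (1 - r / s) := by gcongr
    _ = (s - r) / s := by field_simp
    _ ≤ (s - r) / r := by gcongr
    _ ≤ (s ^ 2 - r ^ 2) / r ^ 2 := by
      rw [div_le_div_iff₀ hr0 (by positivity)]
      nlinarith [mul_nonneg (mul_nonneg (sub_nonneg.2 hrs) hr0.le) hs0.le]

theorem IsSlowWeight.abs_sub_le {g : ℝ → ℝ} (hg : IsSlowWeight g) {A R r s : ℝ} (hA : 1 ≤ A)
    (hR : 0 ≤ R) (hrs : |r - s| ≤ R) (hs : 2 * R + 2 ≤ s) :
    |g r / (A * r ^ 2) - g s / (1 + A * s ^ 2)| ≤ (60 * R + 4) / s ^ 3 := by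
  obtain ⟨hrs₁, hrs₂⟩ := abs_le.1 hrs
  have hA0 : 0 < A := by linarith
  have hs0 : 0 < s := by linarith
  have hr0 : 0 < r := by linarith
  have hhalf : s / 2 ≤ r := by linarith
  have hsq : |r ^ 2 - s ^ 2| ≤ R * (3 * s) := by
    rw [show r ^ 2 - s ^ 2 = (r - s) * (r + s) by ring, abs_mul,
      abs_of_pos (by linarith : 0 < r + s)]
    gcongr
    linarith
  have hrsq : s ^ 2 / 4 ≤ r ^ 2 := by nlinarith
  have hgrs : |g r - g s| ≤ 12 * R / s := by
    have key : |g r - g s| ≤ |r ^ 2 - s ^ 2| / (s ^ 2 / 4) := by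
      rcases le_total r s with h | h
      · obtain ⟨-, h₁, -, h₂⟩ := hg r s (by linarith) h
        rw [abs_of_nonneg (by linarith)]
        refine h₂.trans ?_
        rw [abs_sub_comm]
        gcongr
        exact le_abs_self _
      · obtain ⟨-, h₁, -, h₂⟩ := hg s r (by linarith) h
        rw [abs_of_nonpos (by linarith), neg_sub]
        refine h₂.trans ?_
        gcongr
        · exact le_abs_self _
        · nlinarith
    refine key.trans ?_
    calc _ ≤ R * (3 * s) / (s ^ 2 / 4) := by gcongr
      _ = 12 * R / s := by field_simp; ring
  obtain ⟨hgs0, -, hgs1, -⟩ := hg s s (by linarith) le_rfl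
  have hfirst : |(g r - g s) / (A * r ^ 2)| ≤ 48 * R / s ^ 3 := by
    rw [abs_div, abs_of_pos (by positivity : 0 < A * r ^ 2)]
    calc _ ≤ 12 * R / s / (1 * (s ^ 2 / 4)) := by gcongr
      _ = 48 * R / s ^ 3 := by field_simp; ring
  have hsecond : |g s * ((1 + A * (s ^ 2 - r ^ 2)) / (A * r ^ 2 * (1 + A * s ^ 2)))| ≤
      (12 * R + 4) / s ^ 3 := by
    rw [abs_mul, abs_of_nonneg hgs0, abs_div,
      abs_of_pos (by positivity : 0 < A * r ^ 2 * (1 + A * s ^ 2))]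
    have hnum : |1 + A * (s ^ 2 - r ^ 2)| ≤ A * s * (1 + R * 3) := by
      refine (abs_add_le _ _).trans ?_
      rw [abs_one, abs_mul, abs_of_pos hA0, abs_sub_comm]
      have := mul_le_mul_of_nonneg_left hsq hA0.le
      nlinarith
    calc _ ≤ 1 * (A * s * (1 + R * 3) / (A * (s ^ 2 / 4) * (1 * s ^ 2))) := by
          gcongr
          nlinarith
      _ = (12 * R + 4) / s ^ 3 := by field_simp; ring
  have hsplit : g r / (A * r ^ 2) - g s / (1 + A * s ^ 2) = (g r - g s) / (A * r ^ 2) +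
      g s * ((1 + A * (s ^ 2 - r ^ 2)) / (A * r ^ 2 * (1 + A * s ^ 2))) := by
    field_simp; ring
  rw [hsplit]
  refine (abs_add_le _ _).trans ((add_le_add hfirst hsecond).trans_eq ?_)
  rw [← add_div]; ring

theorem one_le_four_mul_pi_sq : 1 ≤ 4 * Real.pi ^ 2 := by
  nlinarith [Real.pi_gt_three]

theorem abs_gaussian_sub_le {n : ℝ} (hn : 0 < n) {R r s : ℝ} (hR : 0 ≤ R) (hrs : |r - s| ≤ R)
    (hs : 2 * R + 2 ≤ s) :
    |Real.exp (-r ^ 2 / (2 * n ^ 2)) / (4 * Real.pi ^ 2 * r ^ 2) -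
      Real.exp (-s ^ 2 / (2 * n ^ 2)) / (1 + 4 * Real.pi ^ 2 * s ^ 2)| ≤ (60 * R + 4) / s ^ 3 :=
  (isSlowWeight_gaussian hn).abs_sub_le one_le_four_mul_pi_sq hR hrs hs

theorem abs_zeta_sub_le {x : ℝ} (hx₀ : 0 ≤ x) (hx₁ : x ≤ 1) {R r s : ℝ} (hR : 0 ≤ R)
    (hrs : |r - s| ≤ R) (hs : 2 * R + 2 ≤ s) :
    |1 / (4 * Real.pi ^ 2 * r ^ (2 + x)) - 1 / (1 + 4 * Real.pi ^ 2 * s ^ (2 + x))| ≤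
      (60 * R + 5) / s ^ 3 := by
  have hA := one_le_four_mul_pi_sq
  have hmain := (isSlowWeight_rpow_neg hx₀ hx₁).abs_sub_le hA hR hrs hs
  set A := 4 * Real.pi ^ 2
  have hA0 : 0 < A := by linarith
  have hr0 : 0 < r := by linarith [(abs_le.1 hrs).1]
  have hs0 : 0 < s := by linarith
  have hpow {t : ℝ} (ht : 0 < t) : t ^ (2 + x) = t ^ 2 * t ^ x := by
    rw [Real.rpow_add ht, Real.rpow_two]
  have hr : 1 / (A * r ^ (2 + x)) = r ^ (-x) / (A * r ^ 2) := by
    rw [hpow hr0, Real.rpow_neg hr0.le]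
    have := Real.rpow_pos_of_pos hr0 x
    field_simp
  have herr : |s ^ (-x) / (1 + A * s ^ 2) - 1 / (1 + A * s ^ (2 + x))| ≤ 1 / s ^ 3 := by
    rw [hpow hs0, Real.rpow_neg hs0.le]
    have hu : 1 ≤ s ^ x := Real.one_le_rpow (by linarith) hx₀
    set u := s ^ x
    have hu0 : 0 < u := by linarith
    have hid : u⁻¹ / (1 + A * s ^ 2) - 1 / (1 + A * (s ^ 2 * u)) =
        -((u - 1) / (u * ((1 + A * s ^ 2) * (1 + A * (s ^ 2 * u))))) := by
      field_simp; ring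
    rw [hid, abs_neg, abs_of_nonneg (div_nonneg (by linarith) (by positivity))]
    calc _ ≤ u / (u * ((1 * s ^ 2) * (1 * (s ^ 2 * 1)))) := by
          have h₁ : 1 * s ^ 2 ≤ 1 + A * s ^ 2 := by nlinarith
          have h₂ : 1 * (s ^ 2 * 1) ≤ 1 + A * (s ^ 2 * u) :=
            (mul_le_mul hA (mul_le_mul_of_nonneg_left hu (sq_nonneg s)) (by positivity)
              hA0.le).trans (le_add_of_nonneg_left zero_le_one)
          gcongr
          linarith
      _ = 1 / s ^ 4 := by field_simp
      _ ≤ 1 / s ^ 3 := one_div_le_one_div_of_le (by positivity)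
          (pow_le_pow_right₀ (by linarith) (by norm_num))
  rw [hr]
  refine (abs_sub_le _ (s ^ (-x) / (1 + A * s ^ 2)) _).trans
    ((add_le_add hmain herr).trans_eq ?_)
  rw [← add_div]; ring

theorem integrable_gaussian_div {n : ℝ} (hn : 0 < n) {A : ℝ} (hA : 0 ≤ A) :
    Integrable fun y : EuclideanSpace ℝ (Fin 2) =>
      Real.exp (-‖y‖ ^ 2 / (2 * n ^ 2)) / (1 + A * ‖y‖ ^ 2) := by
  have hgauss : Integrable fun y : EuclideanSpace ℝ (Fin 2) =>
      Real.exp (-‖y‖ ^ 2 / (2 * n ^ 2)) := by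
    refine (GaussianFourier.integrable_cexp_neg_mul_sq_norm_add
      (V := EuclideanSpace ℝ (Fin 2)) (b := (((2 * n ^ 2)⁻¹ : ℝ) : ℂ))
      (by rw [Complex.ofReal_re]; positivity) 0 0).norm.congr (ae_of_all _ fun y => ?_)
    simp only [zero_mul, add_zero, Complex.norm_exp]
    congr 1
    norm_cast
    ring
  refine hgauss.mono' (Measurable.aestronglyMeasurable (by fun_prop)) (ae_of_all _ fun y => ?_)
  rw [Real.norm_of_nonneg (by positivity)]
  exact div_le_self (Real.exp_pos _).le (le_add_of_nonneg_right (by positivity))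

theorem integrable_one_div_one_add_rpow {x : ℝ} (hx : 0 < x) {A : ℝ} (hA : 1 ≤ A) :
    Integrable fun y : EuclideanSpace ℝ (Fin 2) => 1 / (1 + A * ‖y‖ ^ (2 + x)) := by
  have hJ : Integrable fun y : EuclideanSpace ℝ (Fin 2) =>
      2 ^ (1 + x) * (1 + ‖y‖) ^ (-(2 + x)) :=
    (integrable_one_add_norm (by simpa using hx)).const_mul _
  refine hJ.mono' (Measurable.aestronglyMeasurable (by fun_prop)) (ae_of_all _ fun y => ?_)
  rw [Real.norm_of_nonneg (by positivity), Real.rpow_neg (by positivity), ← div_eq_mul_inv,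
    div_le_div_iff₀ (by positivity) (by positivity), one_mul]
  have h : (1 + ‖y‖) ^ (2 + x) ≤ 2 ^ (2 + x - 1) * (1 ^ (2 + x) + ‖y‖ ^ (2 + x)) :=
    mod_cast NNReal.rpow_add_le_mul_rpow_add_rpow 1 ‖y‖₊ (by linarith : 1 ≤ 2 + x)
  rw [Real.one_rpow, show 2 + x - 1 = 1 + x by ring] at h
  refine h.trans ?_
  gcongr
  exact le_mul_of_one_le_left (by positivity) hA

/-- The analytic identity (3.14) in the proof of Lemma 3.4: for a lattice
`Λ = ℤv₁ ⊕ ℤv₂ ⊂ ℝ²` of covolume `c`, the Gaussian-regularized and the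
zeta-regularized renormalizations of `Σ_{p ∈ Λ∖{0}} 1/(4π²|p|²)` (each with the
corresponding integral, weighted by `1/c`, subtracted) both converge and have the
same limit. -/
theorem stmt5
    (v₁ v₂ : EuclideanSpace ℝ (Fin 2))
    (hind : LinearIndependent ℝ ![v₁, v₂])
    (c : ℝ) (hc : c = |v₁ 0 * v₂ 1 - v₁ 1 * v₂ 0|) :
    ∃ l : ℝ,
      Tendsto (fun n : ℕ =>
        (∑' q : {q : ℤ × ℤ // q ≠ 0},
          Real.exp (-‖(q.1.1 : ℝ) • v₁ + (q.1.2 : ℝ) • v₂‖ ^ 2 / (2 * (n : ℝ) ^ 2)) /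
            (4 * Real.pi ^ 2 * ‖(q.1.1 : ℝ) • v₁ + (q.1.2 : ℝ) • v₂‖ ^ 2)) -
        (1 / c) * ∫ y : EuclideanSpace ℝ (Fin 2),
          Real.exp (-‖y‖ ^ 2 / (2 * (n : ℝ) ^ 2)) / (1 + 4 * Real.pi ^ 2 * ‖y‖ ^ 2))
        atTop (nhds l) ∧
      Tendsto (fun x : ℝ =>
        (∑' q : {q : ℤ × ℤ // q ≠ 0},
          1 / (4 * Real.pi ^ 2 * ‖(q.1.1 : ℝ) • v₁ + (q.1.2 : ℝ) • v₂‖ ^ ((2 : ℝ) + x))) -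
        (1 / c) * ∫ y : EuclideanSpace ℝ (Fin 2),
          1 / (1 + 4 * Real.pi ^ 2 * ‖y‖ ^ ((2 : ℝ) + x)))
        (nhdsWithin 0 (Set.Ioi 0)) (nhds l) := by
  have hA := one_le_four_mul_pi_sq
  have hpi : 0 < 4 * Real.pi ^ 2 := by linarith
  have hexp (n : ℕ) (r : ℝ) : Real.exp (-r ^ 2 / (2 * (n : ℝ) ^ 2)) ≤ 1 := by
    rw [Real.exp_le_one_iff, neg_div]
    exact neg_nonpos.2 (by positivity)
  have hexp_lim (r : ℝ) :
      Tendsto (fun n : ℕ => Real.exp (-r ^ 2 / (2 * (n : ℝ) ^ 2))) atTop (nhds 1) := by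
    rw [← Real.exp_zero]
    refine (Real.continuous_exp.tendsto 0).comp (tendsto_const_nhds.div_atTop ?_)
    exact ((tendsto_pow_atTop two_ne_zero).comp tendsto_natCast_atTop_atTop).const_mul_atTop
      two_pos
  have hunit : ∀ᶠ x : ℝ in nhdsWithin 0 (Set.Ioi 0), x ∈ Set.Ioc (0 : ℝ) 1 :=
    Ioc_mem_nhdsGT one_pos
  have hrpow_lim (r : ℝ) :
      Tendsto (fun x : ℝ => r ^ (2 + x)) (nhdsWithin 0 (Set.Ioi 0)) (nhds (r ^ 2)) := by
    have hlim : Tendsto (fun x : ℝ => 2 + x) (nhdsWithin 0 (Set.Ioi 0)) (nhds 2) := by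
      have : Tendsto (fun x : ℝ => 2 + x) (nhds 0) (nhds (2 + 0)) := tendsto_id.const_add 2
      rw [add_zero] at this
      exact this.mono_left nhdsWithin_le_nhds
    rw [← Real.rpow_two]
    exact tendsto_const_nhds.rpow hlim (Or.inr two_pos)
  rw [hc]
  refine ⟨_, tendsto_lattice_tsum_sub_integral hind
      (a := fun (n : ℕ) r => Real.exp (-r ^ 2 / (2 * (n : ℝ) ^ 2)) / (4 * Real.pi ^ 2 * r ^ 2))
      (b := fun (n : ℕ) s =>
        Real.exp (-s ^ 2 / (2 * (n : ℝ) ^ 2)) / (1 + 4 * Real.pi ^ 2 * s ^ 2))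
      (α := fun r => 1 / (4 * Real.pi ^ 2 * r ^ 2))
      (β := fun s => 1 / (1 + 4 * Real.pi ^ 2 * s ^ 2)) ?_ ?_ ?_ ?_ ?_ ?_,
    tendsto_lattice_tsum_sub_integral hind
      (a := fun x r => 1 / (4 * Real.pi ^ 2 * r ^ (2 + x)))
      (b := fun x s => 1 / (1 + 4 * Real.pi ^ 2 * s ^ (2 + x)))
      (α := fun r => 1 / (4 * Real.pi ^ 2 * r ^ 2))
      (β := fun s => 1 / (1 + 4 * Real.pi ^ 2 * s ^ 2)) ?_ ?_ ?_ ?_ ?_ ?_⟩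
  · refine fun δ hδ => ⟨1 / (4 * Real.pi ^ 2 * δ ^ 2), .of_forall fun n r hr => ?_⟩
    have hr0 : 0 < r := hδ.trans_le hr
    rw [abs_of_nonneg (by positivity)]
    gcongr
    exact hexp n r
  · refine .of_forall fun n s hs => ?_
    rw [abs_of_nonneg (by positivity), div_le_one (by positivity)]
    exact (hexp n s).trans (le_add_of_nonneg_right (by positivity))
  · refine fun R hR => ⟨60 * R + 4, ?_⟩
    filter_upwards [eventually_gt_atTop 0] with n hn r s hrs hs
    exact abs_gaussian_sub_le (Nat.cast_pos.2 hn) hR hrs hs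
  · filter_upwards [eventually_gt_atTop 0] with n hn
    exact integrable_gaussian_div (Nat.cast_pos.2 hn) hpi.le
  · exact fun r _ => (hexp_lim r).div_const _
  · exact fun s _ => (hexp_lim s).div_const _
  · refine fun δ hδ => ⟨1 / (4 * Real.pi ^ 2 * min (δ ^ 2) (δ ^ 3)), ?_⟩
    filter_upwards [hunit] with x hx r hr
    have hr0 : 0 < r := hδ.trans_le hr
    rw [abs_of_nonneg (by positivity)]
    gcongr
    refine le_trans ?_ (Real.rpow_le_rpow hδ.le hr (by linarith [hx.1]))
    rcases le_total δ 1 with h | h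
    · refine (min_le_right _ _).trans ?_
      rw [← Real.rpow_natCast]
      exact Real.rpow_le_rpow_of_exponent_ge hδ h (by push_cast; linarith [hx.2])
    · refine (min_le_left _ _).trans ?_
      rw [← Real.rpow_natCast]
      exact Real.rpow_le_rpow_of_exponent_le h (by push_cast; linarith [hx.1])
  · refine .of_forall fun x s hs => ?_
    rw [abs_of_nonneg (by positivity), div_le_one (by positivity)]
    exact le_add_of_nonneg_right (by positivity)
  · refine fun R hR => ⟨60 * R + 5, ?_⟩
    filter_upwards [hunit] with x hx r s hrs hs
    exact abs_zeta_sub_le hx.1.le hx.2 hR hrs hs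
  · filter_upwards [hunit] with x hx
    exact integrable_one_div_one_add_rpow hx.1 hA
  · exact fun r hr => tendsto_const_nhds.div ((hrpow_lim r).const_mul _) (by positivity)
  · exact fun s hs => tendsto_const_nhds.div (((hrpow_lim s).const_mul _).const_add 1)
      (by positivity)
end

section
/- Let U ⊆ ℝ² be open, let Λ ⊂ U be a finite nonempty set with n = #Λ, let m ∈ L^∞(U), and let j ∈ L²_loc(U ∖ Λ, ℝ²) satisfy curl j = 2π Σ_{p∈Λ} δ_p − m distributionally in U. Then for every r ∈ (0,1] there exists a finite family 𝔅 of pairwise disjoint closed balls covering Λ whose radii sum to r, such that: (i) for every ball B ∈ 𝔅 with B ⊆ U, writing d_B = #(Λ ∩ B), and every η ∈ (0, r/n], one has ½ ∫_{B ∖ ∪_{p∈Λ} B(p,η)} |j|² ≥ π d_B ( log(r/(nη)) − ‖m‖_∞ r²/2 ); (ii) for every ball B ∈ 𝔅, every nonnegative Lipschitz function χ with compact support contained in U, and every η ∈ (0, r/n], one has ∫_{B ∖ ∪_{p∈Λ} B(p,η)} χ |j|² − 2π ( log(r/(nη)) − ‖m‖_∞ r²/2 ) Σ_{p ∈ B∩Λ}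 χ(p) ≥ −4π r d_B ‖∇χ‖_∞. -/
open MeasureTheory Metric Filter

/-- The Euclidean plane. -/
abbrev E2 : Type := EuclideanSpace ℝ (Fin 2)

section

open Set
open scoped ContDiff Topology

/-- The field `j` on `U` has curl `2π ∑ p ∈ Λ, δ_p - m` in the sense of distributions, with
`|m| ≤ M` almost everywhere, and is locally square integrable away from `Λ`. -/
structure IsVortexField (U : Set E2) (Λ : Finset E2) (m : E2 → ℝ) (M : ℝ) (j : E2 → E2) :
    Prop where
  isOpen : IsOpen U
  bound : ∀ᵐ x ∂(volume.restrict U), |m x| ≤ M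
  locallyIntegrable_m : LocallyIntegrableOn m U volume
  locallyIntegrable : LocallyIntegrableOn j U volume
  locallyIntegrable_sq : LocallyIntegrableOn (fun x => ‖j x‖ ^ 2) (U \ (Λ : Set E2)) volume
  curl : ∀ φ : E2 → ℝ, ContDiff ℝ (⊤ : ℕ∞) φ → HasCompactSupport φ → tsupport φ ⊆ U →
      -∫ x in U, (-(j x 0) * fderiv ℝ φ x (EuclideanSpace.single 1 1) +
          j x 1 * fderiv ℝ φ x (EuclideanSpace.single 0 1)) ∂volume =
        2 * Real.pi * ∑ p ∈ Λ, φ p - ∫ x in U, m x * φ x ∂volume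

theorem integral_comp_normSq (f : ℝ → ℝ) (c : E2) :
    ∫ x : E2, f (‖x - c‖ ^ 2) = Real.pi * ∫ s in Ioi (0 : ℝ), f s := by
  have h1 : ∫ x : E2, f (‖x - c‖ ^ 2) = ∫ x : E2, f (‖x‖ ^ 2) :=
    integral_sub_right_eq_self (fun x : E2 => f (‖x‖ ^ 2)) c
  have h2 := integral_fun_norm_addHaar (volume : Measure E2) (fun t => f (t ^ 2))
  have h3 := integral_comp_rpow_Ioi_of_pos (g := f) (p := 2) (by norm_num)
  have h4 : ∫ x in Ioi (0 : ℝ), (2 * x ^ ((2 : ℝ) - 1)) • f (x ^ (2 : ℝ)) =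
      2 * ∫ x in Ioi (0 : ℝ), x ^ (2 - 1) • f (x ^ 2) := by
    rw [← integral_const_mul]
    refine setIntegral_congr_fun measurableSet_Ioi fun x _ => ?_
    norm_num [mul_assoc]
  have h5 : (volume : Measure E2).real (ball 0 1) = Real.pi := by
    simp [Measure.real, Real.pi_pos.le]
  rw [h1, h2, finrank_euclideanSpace_fin, h5, ← h3, h4]
  simp only [smul_eq_mul, nsmul_eq_mul]
  push_cast
  ring

theorem hasDerivAt_integral_left {G : ℝ → ℝ} (hG : Continuous G) (b s : ℝ) :
    HasDerivAt (fun s => ∫ t in s..b, G t) (-G s) s :=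
  intervalIntegral.integral_hasDerivAt_left (hG.intervalIntegrable _ _)
    hG.stronglyMeasurable.stronglyMeasurableAtFilter hG.continuousAt

theorem contDiff_integral_left {G : ℝ → ℝ} (hG : ContDiff ℝ ∞ G) (b : ℝ) :
    ContDiff ℝ ∞ (fun s => ∫ t in s..b, G t) := by
  have h := hasDerivAt_integral_left hG.continuous b
  refine contDiff_infty_iff_deriv.2 ⟨fun s => (h s).differentiableAt, ?_⟩
  rw [show deriv (fun s => ∫ t in s..b, G t) = fun s => -G s from funext fun s => (h s).deriv]
  exact hG.neg

theorem integral_Ioi_integral_left {G : ℝ → ℝ} (hG : Continuous G) {b : ℝ} (hb : 0 ≤ b)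
    (hGb : ∀ s, b ≤ s → G s = 0) :
    ∫ s in Ioi (0 : ℝ), ∫ t in s..b, G t = ∫ s in 0..b, s * G s := by
  have h0 : ∀ s, b ≤ s → ∫ t in s..b, G t = 0 := fun s hs => by
    rw [intervalIntegral.integral_symm, intervalIntegral.integral_zero_ae, neg_zero]
    refine Eventually.of_forall fun t ht => hGb t ?_
    rw [uIoc_of_le hs] at ht
    exact ht.1.le
  have hd := hasDerivAt_integral_left hG b
  have h1 := intervalIntegral.integral_mul_deriv_eq_deriv_mul (a := 0) (b := b)
    (u := fun s => s) (v := fun s => ∫ t in s..b, G t) (u' := fun _ => 1) (v' := fun s => -G s)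
    (fun s _ => hasDerivAt_id s) (fun s _ => hd s) (by simp) (hG.neg.intervalIntegrable _ _)
  have h2 : ∫ s in Ioi (0 : ℝ), ∫ t in s..b, G t = ∫ s in 0..b, ∫ t in s..b, G t := by
    rw [intervalIntegral.integral_of_le hb]
    refine setIntegral_eq_of_subset_of_forall_sdiff_eq_zero measurableSet_Ioi
      Ioc_subset_Ioi_self fun s hs => h0 s ?_
    by_contra h
    exact hs.2 ⟨hs.1, (not_le.1 h).le⟩
  rw [h2]
  simp only [intervalIntegral.integral_same, mul_zero, zero_mul, sub_self, zero_sub, one_mul,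
    mul_neg, intervalIntegral.integral_neg, neg_inj] at h1
  exact h1.symm

theorem fderiv_comp_normSq {F : ℝ → ℝ} {F' : ℝ} {c x : E2} (hF : HasDerivAt F F' (‖x - c‖ ^ 2))
    (i : Fin 2) :
    fderiv ℝ (fun x : E2 => F (‖x - c‖ ^ 2)) x (EuclideanSpace.single i 1) =
      F' * (2 * (x - c) i) := by
  have h1 : HasFDerivAt (fun x : E2 => ‖x - c‖ ^ 2) (2 • innerSL ℝ (x - c)) x := by
    have := ((hasFDerivAt_id x).sub_const c).norm_sq
    simpa using this
  have h2 := hF.comp_hasFDerivAt x h1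
  have h3 := h2.fderiv
  simp only [Function.comp_def] at h3
  rw [h3]
  simp [EuclideanSpace.inner_single_right]

theorem IsVortexField.integral_radial_ge {U : Set E2} {Λ : Finset E2} {m : E2 → ℝ} {M : ℝ}
    {j : E2 → E2} (h : IsVortexField U Λ m M j) {c : E2} {a b : ℝ} (ha : 0 ≤ a) (hab : a ≤ b)
    {S : Finset E2} (hSΛ : S ⊆ Λ) (hS : ∀ p ∈ S, ‖p - c‖ ^ 2 ≤ a)
    (hΛ : ∀ p ∈ Λ, p ∉ S → b ≤ ‖p - c‖ ^ 2)
    {G : ℝ → ℝ} (hG : ContDiff ℝ ∞ G) (hG0 : ∀ s, 0 ≤ G s) (hGs : ∀ s, G s ≠ 0 → s ∈ Ioo a b)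
    {C : Set E2} (hC : IsClosed C) (hCU : C ⊆ U)
    (hGC : ∀ s, G s ≠ 0 → ∀ x, ‖x - c‖ ^ 2 ≤ s → x ∈ C) :
    2 * Real.pi * S.card * (∫ s in a..b, G s) - M * Real.pi * ∫ s in a..b, s * G s ≤
      ∫ x in U, 2 * G (‖x - c‖ ^ 2) * (j x 1 * (x - c) 0 - j x 0 * (x - c) 1) := by
  have hGc := hG.continuous
  set F : ℝ → ℝ := fun s => ∫ t in s..b, G t with hF
  have hFd : ∀ s, HasDerivAt F (-G s) s := hasDerivAt_integral_left hGc b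
  have hFsmooth : ContDiff ℝ ∞ F := contDiff_integral_left hG b
  have hGb : ∀ s, b ≤ s → G s = 0 := fun s hs => by
    by_contra h'; exact (hGs s h').2.not_ge hs
  have hGa : ∀ s, s ≤ a → G s = 0 := fun s hs => by
    by_contra h'; exact (hGs s h').1.not_ge hs
  have hF0 : ∀ s, F s ≠ 0 → ∃ t, s ≤ t ∧ G t ≠ 0 := fun s hs => by
    by_contra! h'
    refine hs (intervalIntegral.integral_zero_ae (Eventually.of_forall fun t ht => ?_))
    rcases le_total s b with hsb | hsb
    · rw [uIoc_of_le hsb] at ht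
      exact h' t ht.1.le
    · rw [uIoc_of_ge hsb] at ht
      exact hGb t ht.1.le
  have hFa : ∀ s, s ≤ a → F s = ∫ t in a..b, G t := fun s hs => by
    have : ∫ t in s..a, G t = 0 := by
      refine intervalIntegral.integral_zero_ae (Eventually.of_forall fun t ht => ?_)
      rw [uIoc_of_le hs] at ht
      exact hGa t ht.2
    change ∫ t in s..b, G t = _
    rw [← intervalIntegral.integral_add_adjacent_intervals (hGc.intervalIntegrable s a)
      (hGc.intervalIntegrable a b), this, zero_add]
  have hFb : ∀ s, b ≤ s → F s = 0 := fun s hs => by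
    by_contra h'
    obtain ⟨t, ht, ht'⟩ := hF0 s h'
    exact ht' (hGb t (hs.trans ht))
  have hFnn : ∀ s, 0 ≤ F s := fun s => by
    rcases le_total s b with hsb | hsb
    · exact intervalIntegral.integral_nonneg hsb fun t _ => hG0 t
    · exact (hFb s hsb).ge
  have hFcont := hFsmooth.continuous
  set φ : E2 → ℝ := fun x => F (‖x - c‖ ^ 2) with hφ
  have hφs : ContDiff ℝ ∞ φ := hFsmooth.comp ((contDiff_id.sub contDiff_const).norm_sq ℝ)
  have hφsupp : Function.support φ ⊆ C ∩ closedBall c (√b) := fun x hx => by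
    obtain ⟨t, ht, ht'⟩ := hF0 _ hx
    refine ⟨hGC t ht' x ht, ?_⟩
    rw [mem_closedBall, dist_eq_norm]
    exact Real.le_sqrt_of_sq_le (ht.trans (hGs t ht').2.le)
  have hφt : tsupport φ ⊆ C ∩ closedBall c (√b) :=
    closure_minimal hφsupp (hC.inter isClosed_closedBall)
  have hφc : HasCompactSupport φ :=
    (isCompact_closedBall c (√b)).of_isClosed_subset (isClosed_tsupport φ)
      (hφt.trans inter_subset_right)
  have hφU : tsupport φ ⊆ U := (hφt.trans inter_subset_left).trans hCU
  have hcurl := h.curl φ hφs hφc hφU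
  have hleft : -∫ x in U, (-(j x 0) * fderiv ℝ φ x (EuclideanSpace.single 1 1) +
      j x 1 * fderiv ℝ φ x (EuclideanSpace.single 0 1)) =
      ∫ x in U, 2 * G (‖x - c‖ ^ 2) * (j x 1 * (x - c) 0 - j x 0 * (x - c) 1) := by
    rw [← integral_neg]
    refine integral_congr_ae (Eventually.of_forall fun x => ?_)
    simp only [hφ, fderiv_comp_normSq (hFd _)]
    ring
  have hsum : ∑ p ∈ Λ, φ p = S.card * ∫ t in a..b, G t := by
    rw [← Finset.sum_subset hSΛ fun p hp hpS => hFb _ (hΛ p hp hpS),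
      Finset.sum_congr rfl fun p hp => hFa _ (hS p hp)]
    simp
  have hφcont : Continuous φ := hφs.continuous
  have hφint : Integrable φ := hφcont.integrable_of_hasCompactSupport hφc
  have hm : ∫ x in U, m x * φ x ≤ M * Real.pi * ∫ s in a..b, s * G s := by
    have h1 : ∫ x in U, m x * φ x ≤ ∫ x in U, M * φ x := by
      by_cases hi : IntegrableOn (fun x => m x * φ x) U
      · refine integral_mono_ae hi (hφint.integrableOn.const_mul M) ?_
        filter_upwards [h.bound] with x hx
        exact mul_le_mul_of_nonneg_right ((le_abs_self _).trans hx) (hFnn _)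
      · exfalso
        refine hi ?_
        have hK : IntegrableOn (fun x => m x * φ x) (tsupport φ) :=
          (h.locallyIntegrable_m.integrableOn_compact_subset hφU hφc).mul_continuousOn
            hφcont.continuousOn hφc
        refine (hK.integrable_of_forall_notMem_eq_zero fun x hx => ?_).integrableOn
        rw [image_eq_zero_of_notMem_tsupport hx, mul_zero]
    have h2 : ∫ x in U, φ x = ∫ x, φ x :=
      setIntegral_eq_integral_of_forall_compl_eq_zero fun x hx =>
        image_eq_zero_of_notMem_tsupport fun hx' => hx (hφU hx')
    have h3 : ∫ x, φ x = Real.pi * ∫ s in a..b, s * G s := by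
      rw [hφ, integral_comp_normSq F c, integral_Ioi_integral_left hGc (ha.trans hab) hGb]
      have hc : Continuous fun s => s * G s := by fun_prop
      rw [← intervalIntegral.integral_add_adjacent_intervals (hc.intervalIntegrable 0 a)
        (hc.intervalIntegrable a b), intervalIntegral.integral_zero_ae, zero_add]
      refine Eventually.of_forall fun t ht => ?_
      rw [uIoc_of_le ha] at ht
      simp [hGa t ht.2]
    rw [integral_const_mul, h2, h3] at h1
    linarith
  rw [hleft, hsum] at hcurl
  rw [hcurl]
  linarith

theorem two_mul_cross_le (v y : E2) (hy : y ≠ 0) (d : ℝ) :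
    2 * (d / ‖y‖ ^ 2) * (v 1 * y 0 - v 0 * y 1) ≤ ‖v‖ ^ 2 + d ^ 2 / ‖y‖ ^ 2 := by
  have hpos : 0 < ‖y‖ ^ 2 := by positivity
  have hv := EuclideanSpace.norm_sq_eq v
  have hy' := EuclideanSpace.norm_sq_eq y
  simp only [Fin.sum_univ_two, Real.norm_eq_abs, sq_abs] at hv hy'
  set s := ‖y‖ ^ 2
  have key : ‖v‖ ^ 2 + d ^ 2 / s - 2 * (d / s) * (v 1 * y 0 - v 0 * y 1) =
      (v 0 + d / s * y 1) ^ 2 + (v 1 - d / s * y 0) ^ 2 := by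
    have : d ^ 2 / s = (d / s) ^ 2 * (y 0 ^ 2 + y 1 ^ 2) := by
      rw [← hy']; field_simp
    rw [this, hv]; ring
  nlinarith [sq_nonneg (v 0 + d / s * y 1), sq_nonneg (v 1 - d / s * y 0)]

theorem integrable_mul_of_eq_zero {f ρ : E2 → ℝ} {K : Set E2} (hK : IsCompact K)
    (hf : IntegrableOn f K) (hρ : ContinuousOn ρ K) (h0 : ∀ x ∉ K, ρ x = 0) :
    Integrable fun x => ρ x * f x := by
  refine (hf.continuousOn_mul hρ hK).integrable_of_forall_notMem_eq_zero fun x hx => ?_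
  rw [h0 x hx, zero_mul]

theorem IsVortexField.integral_weight_ge {U : Set E2} {Λ : Finset E2} {m : E2 → ℝ} {M : ℝ}
    {j : E2 → E2} (h : IsVortexField U Λ m M j) {c : E2} {a b : ℝ} (ha : 0 < a) (hab : a ≤ b)
    {S : Finset E2} (hSΛ : S ⊆ Λ) (hS : ∀ p ∈ S, ‖p - c‖ ^ 2 < a)
    (hΛ : ∀ p ∈ Λ, p ∉ S → b < ‖p - c‖ ^ 2)
    {g : ℝ → ℝ} (hg : ContDiff ℝ ∞ g) (hg0 : ∀ s, 0 ≤ g s) (hgs : ∀ s, g s ≠ 0 → s ∈ Ioo a b)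
    {C : Set E2} (hC : IsClosed C) (hCU : C ⊆ U)
    (hgC : ∀ s, g s ≠ 0 → ∀ x, ‖x - c‖ ^ 2 ≤ s → x ∈ C) :
    ∫ s in a..b, g s * (Real.pi * S.card ^ 2 / s - Real.pi * M * S.card) ≤
      ∫ x in U, g (‖x - c‖ ^ 2) * ‖j x‖ ^ 2 := by
  set d : ℝ := (S.card : ℝ) with hd
  have hd0 : 0 ≤ d := Nat.cast_nonneg _
  set G : ℝ → ℝ := fun s => g s * (d / s) with hGdef
  have hGg : ∀ s, G s ≠ 0 → g s ≠ 0 := fun s hs => left_ne_zero_of_mul hs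
  have hG : ContDiff ℝ ∞ G := by
    refine contDiff_iff_contDiffAt.2 fun s => ?_
    rcases eq_or_ne s 0 with rfl | hs
    · refine (contDiffAt_const (c := (0 : ℝ))).congr_of_eventuallyEq ?_
      filter_upwards [Iio_mem_nhds ha] with t ht
      by_contra h'
      exact (hgs t (hGg t h')).1.not_gt ht
    · exact hg.contDiffAt.mul (contDiffAt_const.div contDiffAt_id hs)
  have hGc := hG.continuous
  have hgc := hg.continuous
  have hpos : ∀ s, g s ≠ 0 → 0 < s := fun s hs => ha.trans (hgs s hs).1
  have hG0 : ∀ s, 0 ≤ G s := fun s => by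
    by_cases hs : g s = 0
    · simp [hGdef, hs]
    · have := hpos s hs
      have := hg0 s
      positivity
  have key := h.integral_radial_ge ha.le hab hSΛ (fun p hp => (hS p hp).le)
    (fun p hp hpS => (hΛ p hp hpS).le) hG hG0 (fun s hs => hgs s (hGg s hs)) hC hCU
    (fun s hs => hgC s (hGg s hs))
  rw [← hd] at key
  set K : Set E2 := C ∩ {x | a ≤ ‖x - c‖ ^ 2 ∧ ‖x - c‖ ^ 2 ≤ b} with hKdef
  have hK : IsCompact K := by
    refine (isCompact_closedBall c (√b)).of_isClosed_subset (hC.inter ?_) fun x hx => ?_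
    · exact isClosed_Icc.preimage (f := fun x : E2 => ‖x - c‖ ^ 2) (by fun_prop)
    · rw [mem_closedBall, dist_eq_norm]
      exact Real.le_sqrt_of_sq_le hx.2.2
  have hKU : K ⊆ U := inter_subset_left.trans hCU
  have hKΛ : K ⊆ U \ (Λ : Set E2) := fun x hx => by
    refine ⟨hKU hx, fun hxΛ => ?_⟩
    by_cases hxS : x ∈ S
    · exact (hS x hxS).not_ge hx.2.1
    · exact (hΛ x hxΛ hxS).not_ge hx.2.2
  have hgK : ∀ x ∉ K, g (‖x - c‖ ^ 2) = 0 := fun x hx => by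
    by_contra h'
    have := hgs _ h'
    exact hx ⟨hgC _ h' x le_rfl, this.1.le, this.2.le⟩
  have hGK : ∀ x ∉ K, G (‖x - c‖ ^ 2) = 0 := fun x hx => by simp [hGdef, hgK x hx]
  have hjK : IntegrableOn j K := h.locallyIntegrable.integrableOn_compact_subset hKU hK
  have hji : ∀ i : Fin 2, IntegrableOn (fun x => j x i) K := fun i =>
    (EuclideanSpace.proj i : E2 →L[ℝ] ℝ).integrable_comp hjK
  have hI1 : Integrable fun x => g (‖x - c‖ ^ 2) * ‖j x‖ ^ 2 :=
    integrable_mul_of_eq_zero hK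
      (h.locallyIntegrable_sq.integrableOn_compact_subset hKΛ hK)
      (by fun_prop) hgK
  have hI2 : Integrable fun x : E2 => d * G (‖x - c‖ ^ 2) :=
    (Continuous.integrable_of_hasCompactSupport (by fun_prop)
      (HasCompactSupport.intro hK hGK)).const_mul d
  have hI3 : Integrable fun x =>
      2 * G (‖x - c‖ ^ 2) * (j x 1 * (x - c) 0 - j x 0 * (x - c) 1) := by
    refine integrable_mul_of_eq_zero hK (((hji 1).mul_continuousOn ?_ hK).sub
      ((hji 0).mul_continuousOn ?_ hK)) (by fun_prop) fun x hx => by simp [hGK x hx]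
    · exact Continuous.continuousOn (by fun_prop)
    · exact Continuous.continuousOn (by fun_prop)
  have hmono : ∫ x in U, 2 * G (‖x - c‖ ^ 2) * (j x 1 * (x - c) 0 - j x 0 * (x - c) 1) ≤
      ∫ x in U, (g (‖x - c‖ ^ 2) * ‖j x‖ ^ 2 + d * G (‖x - c‖ ^ 2)) := by
    refine integral_mono hI3.integrableOn (hI1.add hI2).integrableOn fun x => ?_
    by_cases hs : g (‖x - c‖ ^ 2) = 0
    · simp [hGdef, hs]
    · have hx : x - c ≠ 0 := fun h' => by simpa [h'] using hpos _ hs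
      have := mul_le_mul_of_nonneg_left (two_mul_cross_le (j x) (x - c) hx d)
        (hg0 (‖x - c‖ ^ 2))
      simp only [hGdef]
      calc _ = g (‖x - c‖ ^ 2) * (2 * (d / ‖x - c‖ ^ 2) *
            (j x 1 * (x - c) 0 - j x 0 * (x - c) 1)) := by ring
        _ ≤ _ := this
        _ = _ := by ring
  rw [integral_add hI1.integrableOn hI2.integrableOn, integral_const_mul,
    setIntegral_eq_integral_of_forall_compl_eq_zero (f := fun x => G (‖x - c‖ ^ 2))
      (fun x hx => hGK x fun hx' => hx (hKU hx')), integral_comp_normSq G c] at hmono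
  have hGint : ∫ s in Ioi (0 : ℝ), G s = ∫ s in a..b, G s := by
    rw [intervalIntegral.integral_of_le hab]
    refine setIntegral_eq_of_subset_of_forall_sdiff_eq_zero measurableSet_Ioi
      (fun s hs => ha.trans hs.1) fun s hs => ?_
    by_contra h'
    have := hgs s (hGg s h')
    exact hs.2 ⟨this.1, this.2.le⟩
  have hsG : ∫ s in a..b, s * G s = d * ∫ s in a..b, g s := by
    rw [← intervalIntegral.integral_const_mul]
    refine intervalIntegral.integral_congr fun s hs => ?_
    rw [uIcc_of_le hab] at hs
    have : s ≠ 0 := (ha.trans_le hs.1).ne'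
    simp only [hGdef]
    field_simp
  have hsplit : ∫ s in a..b, g s * (Real.pi * d ^ 2 / s - Real.pi * M * d) =
      Real.pi * d * (∫ s in a..b, G s) - Real.pi * M * d * ∫ s in a..b, g s := by
    rw [← intervalIntegral.integral_const_mul, ← intervalIntegral.integral_const_mul,
      ← intervalIntegral.integral_sub ((hGc.intervalIntegrable _ _).const_mul _)
      ((hgc.intervalIntegrable _ _).const_mul _)]
    refine intervalIntegral.integral_congr fun s _ => ?_
    simp only [hGdef]
    ring
  rw [hsplit]
  rw [hGint] at hmono
  rw [hsG] at key
  linarith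

theorem tendsto_smoothTransition_mul {x : ℝ} (hx : 0 < x) :
    Tendsto (fun k : ℕ => Real.smoothTransition ((k + 1) * x)) atTop (𝓝 1) := by
  have h : Tendsto (fun k : ℕ => ((k : ℝ) + 1) * x) atTop atTop :=
    (tendsto_natCast_atTop_atTop.atTop_add tendsto_const_nhds).atTop_mul_const hx
  refine tendsto_const_nhds.congr' ?_
  filter_upwards [h.eventually_ge_atTop 1] with k hk
  exact (Real.smoothTransition.one_of_one_le hk).symm

/-- A smooth function supported in `[a, b]`, converging to the positive part of `w` on `(a, b)`
as `k` tends to infinity. -/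
noncomputable def smoothTruncation (w : ℝ → ℝ) (a b : ℝ) (k : ℕ) (s : ℝ) : ℝ :=
  w s * Real.smoothTransition ((k + 1) * w s) *
    (Real.smoothTransition ((k + 1) * (s - a)) * Real.smoothTransition ((k + 1) * (b - s)))

section smoothTruncation

variable {w : ℝ → ℝ} {a b : ℝ} {k : ℕ} {s : ℝ}

theorem smoothTruncation_ne_zero (h : smoothTruncation w a b k s ≠ 0) :
    0 < w s ∧ s ∈ Ioo a b := by
  have hk : (0 : ℝ) < k + 1 := by positivity
  simp only [smoothTruncation, ne_eq, mul_eq_zero, Real.smoothTransition.zero_iff_nonpos,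
    not_or, not_le] at h
  obtain ⟨⟨_, h1⟩, h2, h3⟩ := h
  exact ⟨pos_of_mul_pos_right h1 hk.le, sub_pos.1 (pos_of_mul_pos_right h2 hk.le),
    sub_pos.1 (pos_of_mul_pos_right h3 hk.le)⟩

theorem smoothTruncation_nonneg : 0 ≤ smoothTruncation w a b k s := by
  by_cases h : smoothTruncation w a b k s = 0
  · exact h.ge
  · have h1 := (smoothTruncation_ne_zero h).1
    exact mul_nonneg (mul_nonneg h1.le (Real.smoothTransition.nonneg _))
      (mul_nonneg (Real.smoothTransition.nonneg _) (Real.smoothTransition.nonneg _))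

theorem smoothTruncation_le : smoothTruncation w a b k s ≤ max (w s) 0 := by
  by_cases h : smoothTruncation w a b k s = 0
  · rw [h]; exact le_max_right _ _
  · have h1 := (smoothTruncation_ne_zero h).1
    refine le_trans ?_ (le_max_left _ _)
    have h2 : w s * Real.smoothTransition ((k + 1) * w s) ≤ w s :=
      mul_le_of_le_one_right h1.le (Real.smoothTransition.le_one _)
    refine (mul_le_of_le_one_right (mul_nonneg h1.le (Real.smoothTransition.nonneg _)) ?_).trans h2
    exact mul_le_one₀ (Real.smoothTransition.le_one _) (Real.smoothTransition.nonneg _)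
      (Real.smoothTransition.le_one _)

theorem contDiff_smoothTruncation (ha : 0 < a) (hw : ∀ s, s ≠ 0 → ContDiffAt ℝ ∞ w s) :
    ContDiff ℝ ∞ (smoothTruncation w a b k) := by
  refine contDiff_iff_contDiffAt.2 fun s => ?_
  rcases eq_or_ne s 0 with rfl | hs
  · refine (contDiffAt_const (c := (0 : ℝ))).congr_of_eventuallyEq ?_
    filter_upwards [Iio_mem_nhds ha] with t ht
    by_contra h'
    exact (smoothTruncation_ne_zero h').2.1.not_gt ht
  · have hT : ∀ {f : ℝ → ℝ}, ContDiffAt ℝ ∞ f s →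
        ContDiffAt ℝ ∞ (fun t => Real.smoothTransition (f t)) s := fun hf =>
      (Real.smoothTransition.contDiffAt (n := ⊤)).comp s hf
    have h := hw s hs
    exact (h.mul (hT (contDiffAt_const.mul h))).mul
      ((hT (contDiffAt_const.mul (contDiffAt_id.sub contDiffAt_const))).mul
        (hT (contDiffAt_const.mul (contDiffAt_const.sub contDiffAt_id))))

theorem tendsto_smoothTruncation (hs : s ∈ Ioo a b) :
    Tendsto (fun k => smoothTruncation w a b k s) atTop (𝓝 (max (w s) 0)) := by
  rcases le_or_gt (w s) 0 with h | h
  · rw [max_eq_right h]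
    refine tendsto_const_nhds.congr fun k => ?_
    by_contra h'
    exact (smoothTruncation_ne_zero (Ne.symm h')).1.not_ge h
  · rw [max_eq_left h.le]
    simpa [smoothTruncation] using ((tendsto_const_nhds (x := w s) (f := atTop (α := ℕ))).mul
      (tendsto_smoothTransition_mul h)).mul
      ((tendsto_smoothTransition_mul (sub_pos.2 hs.1)).mul
        (tendsto_smoothTransition_mul (sub_pos.2 hs.2)))

end smoothTruncation

theorem IsVortexField.integrableOn_mul_sq {U : Set E2} {Λ : Finset E2} {m : E2 → ℝ} {M : ℝ}
    {j : E2 → E2} (h : IsVortexField U Λ m M j) {χ : E2 → ℝ} (hχ : Continuous χ)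
    {A A' : Set E2} (hA : MeasurableSet A) (hAA' : A ⊆ A') (hA' : IsCompact A')
    (hχA : tsupport χ ∩ A' ⊆ U \ (Λ : Set E2)) :
    IntegrableOn (fun x => χ x * ‖j x‖ ^ 2) A := by
  have hK : IsCompact (tsupport χ ∩ A') := hA'.inter_left (isClosed_tsupport χ)
  refine IntegrableOn.of_forall_sdiff_eq_zero
    ((h.locallyIntegrable_sq.integrableOn_compact_subset hχA hK).continuousOn_mul
      hχ.continuousOn hK) hA fun x hx => ?_
  rw [image_eq_zero_of_notMem_tsupport fun hx' => hx.2 ⟨hx', hAA' hx.1⟩, zero_mul]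

theorem IsVortexField.integral_annulus_ge_truncated {U : Set E2} {Λ : Finset E2} {m : E2 → ℝ}
    {M : ℝ} {j : E2 → E2} (h : IsVortexField U Λ m M j) {c : E2} {ρ₀ ρ₁ : ℝ}
    (h0 : 0 < ρ₀) (h01 : ρ₀ ≤ ρ₁) {S : Finset E2} (hSΛ : S ⊆ Λ)
    (hS : ∀ p ∈ S, dist p c < ρ₀) (hΛ : ∀ p ∈ Λ, p ∉ S → ρ₁ < dist p c)
    {χ : E2 → ℝ} {K : NNReal} (hχ0 : ∀ x, 0 ≤ χ x) (hχ : LipschitzWith K χ)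
    (hχU : tsupport χ ∩ closedBall c ρ₁ ⊆ U) :
    ∫ s in ρ₀ ^ 2..ρ₁ ^ 2,
        max (χ c - K * √s) 0 * (Real.pi * S.card ^ 2 / s - Real.pi * M * S.card) ≤
      ∫ x in ball c ρ₁ \ closedBall c ρ₀, χ x * ‖j x‖ ^ 2 := by
  have h1 : 0 < ρ₁ := h0.trans_le h01
  set a := ρ₀ ^ 2 with ha
  set b := ρ₁ ^ 2 with hb
  have ha0 : 0 < a := by positivity
  have hab : a ≤ b := pow_le_pow_left₀ h0.le h01 2
  set w : ℝ → ℝ := fun s => χ c - K * √s with hw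
  set e : ℝ → ℝ := fun s => Real.pi * S.card ^ 2 / s - Real.pi * M * S.card with he
  have hχw : ∀ x, χ c - K * ‖x - c‖ ≤ χ x := fun x => by
    have := hχ.dist_le_mul c x
    rw [Real.dist_eq, dist_comm, dist_eq_norm] at this
    linarith [le_abs_self (χ c - χ x)]
  have hwχ : ∀ x, w (‖x - c‖ ^ 2) ≤ χ x := fun x => by
    simpa [hw, Real.sqrt_sq (norm_nonneg (x - c))] using hχw x
  have hsmooth : ∀ k, ContDiff ℝ ∞ (smoothTruncation w a b k) := fun k =>
    contDiff_smoothTruncation ha0 fun s hs =>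
      contDiffAt_const.sub (contDiffAt_const.mul (Real.contDiffAt_sqrt hs))
  have hint : IntegrableOn (fun x => χ x * ‖j x‖ ^ 2) (ball c ρ₁ \ closedBall c ρ₀) := by
    refine h.integrableOn_mul_sq hχ.continuous (measurableSet_ball.diff measurableSet_closedBall)
      (A' := closedBall c ρ₁ \ ball c ρ₀) (sdiff_subset_sdiff ball_subset_closedBall
        ball_subset_closedBall) ((isCompact_closedBall c ρ₁).diff isOpen_ball) fun x hx => ?_
    refine ⟨hχU ⟨hx.1, hx.2.1⟩, fun hxΛ => ?_⟩
    by_cases hxS : x ∈ S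
    · exact hx.2.2 (hS x hxS)
    · exact (hΛ x hxΛ hxS).not_ge hx.2.1
  have hann : ∀ k, ∀ x, smoothTruncation w a b k (‖x - c‖ ^ 2) ≠ 0 →
      x ∈ ball c ρ₁ \ closedBall c ρ₀ ∧ x ∈ U := fun k x hx => by
    obtain ⟨h2, h3, h4⟩ := smoothTruncation_ne_zero hx
    have h5 : x ∈ ball c ρ₁ := by
      rw [mem_ball, dist_eq_norm]; exact lt_of_pow_lt_pow_left₀ 2 h1.le h4
    refine ⟨⟨h5, ?_⟩, hχU ⟨subset_tsupport χ (h2.trans_le (hwχ x)).ne', ball_subset_closedBall h5⟩⟩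
    rw [mem_closedBall, dist_eq_norm, not_le]
    exact lt_of_pow_lt_pow_left₀ 2 (norm_nonneg _) h3
  have hk : ∀ k, ∫ s in a..b, smoothTruncation w a b k s * e s ≤
      ∫ x in ball c ρ₁ \ closedBall c ρ₀, χ x * ‖j x‖ ^ 2 := fun k => by
    refine (h.integral_weight_ge (c := c) ha0 hab hSΛ (fun p hp => ?_) (fun p hp hpS => ?_)
      (hsmooth k) (fun s => smoothTruncation_nonneg) (fun s hs => (smoothTruncation_ne_zero hs).2)
      ((isClosed_tsupport χ).inter (isClosed_closedBall (x := c) (ε := ρ₁))) hχU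
      fun s hs x hx => ?_).trans ?_
    · have := hS p hp
      rw [dist_eq_norm] at this
      exact pow_lt_pow_left₀ this (norm_nonneg _) two_ne_zero
    · have := hΛ p hp hpS
      rw [dist_eq_norm] at this
      exact pow_lt_pow_left₀ this h1.le two_ne_zero
    · obtain ⟨h2, -, h4⟩ := smoothTruncation_ne_zero hs
      refine ⟨subset_tsupport χ (ne_of_gt (h2.trans_le ?_)), ?_⟩
      · refine le_trans ?_ (hχw x)
        have : ‖x - c‖ ≤ √s := Real.le_sqrt_of_sq_le hx
        have := mul_le_mul_of_nonneg_left this K.2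
        simp only [hw, NNReal.val_eq_coe] at this ⊢
        linarith
      · rw [mem_closedBall, dist_eq_norm]
        exact le_of_sq_le_sq (hx.trans h4.le) h1.le
    · rw [setIntegral_eq_integral_of_forall_compl_eq_zero
          (fun x hx => by rw [not_ne_iff.1 fun h' => hx (hann k x h').2, zero_mul]),
        ← setIntegral_eq_integral_of_forall_compl_eq_zero (s := ball c ρ₁ \ closedBall c ρ₀)
          (fun x hx => by rw [not_ne_iff.1 fun h' => hx (hann k x h').1, zero_mul])]
      refine integral_mono_of_nonneg (Eventually.of_forall fun x => ?_) hint
        (Eventually.of_forall fun x => ?_)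
      · exact mul_nonneg smoothTruncation_nonneg (sq_nonneg _)
      · exact mul_le_mul_of_nonneg_right (smoothTruncation_le.trans (max_le (hwχ x) (hχ0 x)))
          (sq_nonneg _)
  have hecont : ContinuousOn e (uIcc a b) := by
    rw [uIcc_of_le hab]
    refine (continuousOn_const.div continuousOn_id fun s hs => ?_).sub continuousOn_const
    exact (ha0.trans_le hs.1).ne'
  refine le_of_tendsto' (intervalIntegral.tendsto_integral_filter_of_dominated_convergence
    (l := atTop) (fun s => χ c * |e s|) ?_ ?_ ?_ ?_) hk
  · refine Eventually.of_forall fun k => ContinuousOn.aestronglyMeasurable ?_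
      measurableSet_uIoc
    exact (hsmooth k).continuous.continuousOn.mul (hecont.mono uIoc_subset_uIcc)
  · refine Eventually.of_forall fun k => Eventually.of_forall fun s _ => ?_
    rw [Real.norm_eq_abs, abs_mul, abs_of_nonneg smoothTruncation_nonneg]
    refine mul_le_mul_of_nonneg_right (smoothTruncation_le.trans (max_le ?_ (hχ0 c)))
      (abs_nonneg _)
    have : 0 ≤ K * √s := by positivity
    simp only [hw]
    linarith
  · exact (continuousOn_const.mul hecont.abs).intervalIntegrable
  · have : ∀ᵐ s : ℝ, s ≠ b := by simp [ae_iff]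
    filter_upwards [this] with s hsb hs
    rw [uIoc_of_le hab] at hs
    exact (tendsto_smoothTruncation ⟨hs.1, lt_of_le_of_ne hs.2 hsb⟩).mul_const _

/-- The lower bound for the `χ`-weighted energy carried by the annulus of radii `S.card * τ₀` and
`S.card * τ₁` around the cluster `S`, for a `K`-Lipschitz weight `χ`. -/
noncomputable def vortexGain (χ : E2 → ℝ) (S : Finset E2) (N M K τ₀ τ₁ : ℝ) : ℝ :=
  2 * Real.pi * ((∑ p ∈ S, χ p) *
      (Real.log τ₁ - Real.log τ₀ - N ^ 2 * M * (τ₁ ^ 2 - τ₀ ^ 2) / 2) -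
    2 * N * K * S.card * (τ₁ - τ₀))

theorem vortexGain_eq_integral (χ : E2 → ℝ) {S : Finset E2} (hSne : S.Nonempty) (N M K : ℝ)
    {τ₀ τ₁ : ℝ} (h0 : 0 < τ₀) (h01 : τ₀ ≤ τ₁) :
    IntervalIntegrable (fun s => Real.pi * (∑ p ∈ S, χ p) * (s⁻¹ - N ^ 2 * M / (S.card : ℝ) ^ 2) -
      2 * Real.pi * N * K / √s) volume ((S.card * τ₀) ^ 2) ((S.card * τ₁) ^ 2) ∧
    vortexGain χ S N M K τ₀ τ₁ = ∫ s in (S.card * τ₀) ^ 2..(S.card * τ₁) ^ 2,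
      (Real.pi * (∑ p ∈ S, χ p) * (s⁻¹ - N ^ 2 * M / (S.card : ℝ) ^ 2) -
        2 * Real.pi * N * K / √s) := by
  have hd : (0 : ℝ) < S.card := Nat.cast_pos.2 hSne.card_pos
  have h1 : 0 < τ₁ := h0.trans_le h01
  set A := ∑ p ∈ S, χ p with hA
  set d : ℝ := (S.card : ℝ) with hd'
  have hab : (d * τ₀) ^ 2 ≤ (d * τ₁) ^ 2 := by gcongr
  have hpos : ∀ s ∈ uIcc ((d * τ₀) ^ 2) ((d * τ₁) ^ 2), 0 < s := fun s hs => by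
    rw [uIcc_of_le hab] at hs
    exact lt_of_lt_of_le (by positivity) hs.1
  have hi : IntervalIntegrable (fun s => Real.pi * A * (s⁻¹ - N ^ 2 * M / d ^ 2) -
      2 * Real.pi * N * K / √s) volume ((d * τ₀) ^ 2) ((d * τ₁) ^ 2) := by
    refine ContinuousOn.intervalIntegrable fun s hs => ContinuousAt.continuousWithinAt ?_
    have h2 := (hpos s hs).ne'
    have h3 := (Real.sqrt_pos.2 (hpos s hs)).ne'
    fun_prop (disch := assumption)
  refine ⟨hi, ?_⟩
  have hderiv : ∀ s ∈ uIcc ((d * τ₀) ^ 2) ((d * τ₁) ^ 2), HasDerivAt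
      (fun s => Real.pi * A * (Real.log s - N ^ 2 * M / d ^ 2 * s) - 4 * Real.pi * N * K * √s)
      (Real.pi * A * (s⁻¹ - N ^ 2 * M / d ^ 2) - 2 * Real.pi * N * K / √s) s := fun s hs => by
    have h2 := (hpos s hs).ne'
    have h3 := (Real.sqrt_pos.2 (hpos s hs)).ne'
    refine ((((Real.hasDerivAt_log h2).sub ((hasDerivAt_id s).const_mul
      (N ^ 2 * M / d ^ 2))).const_mul (Real.pi * A)).sub
      ((Real.hasDerivAt_sqrt h2).const_mul (4 * Real.pi * N * K))).congr_deriv ?_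
    field_simp
    ring
  rw [intervalIntegral.integral_eq_sub_of_hasDerivAt hderiv hi]
  simp only [vortexGain, ← hA, ← hd']
  rw [Real.sqrt_sq (by positivity), Real.sqrt_sq (by positivity), Real.log_pow, Real.log_pow,
    Real.log_mul hd.ne' h0.ne', Real.log_mul hd.ne' h1.ne']
  field_simp
  push_cast
  ring

theorem IsVortexField.integral_annulus_ge {U : Set E2} {Λ : Finset E2} {m : E2 → ℝ}
    {M : ℝ} {j : E2 → E2} (h : IsVortexField U Λ m M j) (hM : 0 ≤ M) {c : E2} {τ₀ τ₁ : ℝ}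
    (h0 : 0 < τ₀) (h01 : τ₀ ≤ τ₁) {S : Finset E2} (hSΛ : S ⊆ Λ) (hSne : S.Nonempty)
    (hS : ∀ p ∈ S, dist p c < S.card * τ₀) (hΛ : ∀ p ∈ Λ, p ∉ S → S.card * τ₁ < dist p c)
    {χ : E2 → ℝ} {K : NNReal} (hχ0 : ∀ x, 0 ≤ χ x) (hχ : LipschitzWith K χ)
    (hχU : tsupport χ ∩ closedBall c (S.card * τ₁) ⊆ U) :
    vortexGain χ S Λ.card M K τ₀ τ₁ ≤
      ∫ x in ball c (S.card * τ₁) \ closedBall c (S.card * τ₀), χ x * ‖j x‖ ^ 2 := by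
  have hd1 : (1 : ℝ) ≤ S.card := Nat.one_le_cast.2 hSne.card_pos
  have hdN : (S.card : ℝ) ≤ Λ.card := Nat.cast_le.2 (Finset.card_le_card hSΛ)
  obtain ⟨hi, heq⟩ := vortexGain_eq_integral χ hSne Λ.card M K h0 h01
  have htr := h.integral_annulus_ge_truncated (by positivity) (by gcongr) hSΛ hS hΛ hχ0 hχ hχU
  rw [heq]
  refine le_trans ?_ htr
  have hab : (S.card * τ₀) ^ 2 ≤ (S.card * τ₁) ^ 2 := by gcongr
  have hpos : ∀ s ∈ Icc ((S.card * τ₀) ^ 2) ((S.card * τ₁) ^ 2), 0 < s := fun s hs =>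
    lt_of_lt_of_le (by positivity) hs.1
  refine intervalIntegral.integral_mono_on hab hi (ContinuousOn.intervalIntegrable ?_)
    fun s hs => ?_
  · rw [uIcc_of_le hab]
    intro s hs
    have h2 := (hpos s hs).ne'
    refine ContinuousAt.continuousWithinAt ?_
    fun_prop (disch := assumption)
  have hs0 := hpos s hs
  set q := √s with hq
  have hq0 : 0 < q := Real.sqrt_pos.2 hs0
  have hqs : s = q ^ 2 := (Real.sq_sqrt hs0.le).symm
  have hτq : S.card * τ₀ ≤ q := Real.le_sqrt_of_sq_le hs.1
  set W := max (χ c - K * q) 0 with hW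
  set A := ∑ p ∈ S, χ p with hA
  have hpq : ∀ p ∈ S, χ p - 2 * K * q ≤ W ∧ W ≤ χ p := fun p hp => by
    have h2 := hχ.dist_le_mul p c
    have h3 := mul_le_mul_of_nonneg_left ((hS p hp).le.trans hτq) K.coe_nonneg
    rw [Real.dist_eq, abs_le] at h2
    exact ⟨le_trans (by linarith) (le_max_left _ _), max_le (by linarith) (hχ0 p)⟩
  have hA1 : A - S.card * (2 * K * q) ≤ S.card * W := by
    have := Finset.sum_le_sum fun p hp => (hpq p hp).1
    simpa [Finset.sum_sub_distrib, ← hA] using this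
  have hA2 : S.card * W ≤ A := by
    have := Finset.sum_le_sum fun p hp => (hpq p hp).2
    simpa [← hA] using this
  have hW0 : 0 ≤ W := le_max_right _ _
  have hK0 : (0 : ℝ) ≤ K := K.coe_nonneg
  set d : ℝ := (S.card : ℝ) with hd
  set N : ℝ := (Λ.card : ℝ) with hN
  have hd0 : 0 < d := zero_lt_one.trans_le hd1
  have hN0 : 0 < N := hd0.trans_le hdN
  have hA0 : 0 ≤ A := (mul_nonneg hd0.le hW0).trans hA2
  clear_value W A q d N
  have e1 : A * s⁻¹ ≤ W * d ^ 2 / s + 2 * N * K / q := by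
    have : A ≤ W * d ^ 2 + 2 * N * K * q := by
      have : d * W ≤ W * d ^ 2 := by nlinarith [mul_nonneg hW0 (sub_nonneg.2 hd1)]
      have : d * (2 * K * q) ≤ N * (2 * K * q) := by gcongr
      linarith
    rw [hqs]
    calc A * (q ^ 2)⁻¹ ≤ (W * d ^ 2 + 2 * N * K * q) * (q ^ 2)⁻¹ := by gcongr
      _ = _ := by field_simp
  have e2 : M * d * W ≤ A * (N ^ 2 * M / d ^ 2) := by
    have h2 : 1 ≤ N ^ 2 / d ^ 2 := by
      rw [one_le_div (by positivity)]; gcongr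
    calc M * d * W = (d * W * M) * 1 := by ring
      _ ≤ (A * M) * (N ^ 2 / d ^ 2) := by gcongr
      _ = _ := by ring
  have := mul_le_mul_of_nonneg_left (add_le_add e1 e2) Real.pi_pos.le
  calc _ = Real.pi * (A * s⁻¹) - Real.pi * (A * (N ^ 2 * M / d ^ 2)) - Real.pi *
        (2 * N * K / q) := by ring
    _ ≤ Real.pi * (W * d ^ 2 / s) - Real.pi * (M * d * W) := by linarith
    _ = _ := by ring

theorem IsVortexField.integrableOn_perforated {U : Set E2} {Λ : Finset E2} {m : E2 → ℝ} {M : ℝ}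
    {j : E2 → E2} (h : IsVortexField U Λ m M j) {χ : E2 → ℝ} (hχ : Continuous χ) {c : E2} {R : ℝ}
    (hχU : tsupport χ ∩ closedBall c R ⊆ U) {A : Set E2} (hA : MeasurableSet A)
    (hAR : A ⊆ closedBall c R) {η : ℝ} (hη : 0 < η) :
    IntegrableOn (fun x => χ x * ‖j x‖ ^ 2) (A \ ⋃ p ∈ Λ, ball p η) := by
  have hopen : IsOpen (⋃ p ∈ Λ, ball p η) := isOpen_biUnion fun _ _ => isOpen_ball
  refine h.integrableOn_mul_sq hχ (hA.diff hopen.measurableSet)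
    (sdiff_subset_sdiff_left hAR) ((isCompact_closedBall c R).diff hopen) fun x hx => ?_
  exact ⟨hχU ⟨hx.1, hx.2.1⟩, fun hxΛ => hx.2.2 (mem_biUnion hxΛ (mem_ball_self hη))⟩

/-- A partition `P` of `Λ` into clusters, where the cluster `S` is enclosed in the ball of
center `c S` and radius `S.card * τ`, and where the energy of `j` carried by the disjoint sets
`D S` obeys the expected lower bound. -/
structure IsClusterConfig (U : Set E2) (Λ : Finset E2) (M : ℝ) (j : E2 → E2) (τ : ℝ)
    (P : Finset (Finset E2)) (c : Finset E2 → E2) (D : Finset E2 → Set E2) : Prop where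
  subset : ∀ S ∈ P, S ⊆ Λ
  nonempty : ∀ S ∈ P, S.Nonempty
  disjoint : (P : Set (Finset E2)).PairwiseDisjoint id
  cover : ∀ p ∈ Λ, ∃ S ∈ P, p ∈ S
  dist_center_le : ∀ S ∈ P, ∀ p ∈ S, dist p (c S) ≤ (S.card - 1) * τ
  measurableSet : ∀ S ∈ P, MeasurableSet (D S)
  subset_closedBall : ∀ S ∈ P, D S ⊆ closedBall (c S) (S.card * τ)
  pairwiseDisjoint : (P : Set (Finset E2)).PairwiseDisjoint D
  gain_le : ∀ S ∈ P, ∀ (χ : E2 → ℝ) (K : NNReal), (∀ x, 0 ≤ χ x) → LipschitzWith K χ →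
    tsupport χ ∩ closedBall (c S) (S.card * τ) ⊆ U → ∀ η, 0 < η → η ≤ τ →
    vortexGain χ S Λ.card M K η τ ≤ ∫ x in D S \ ⋃ p ∈ Λ, ball p η, χ x * ‖j x‖ ^ 2

namespace IsClusterConfig

variable {U : Set E2} {Λ : Finset E2} {m : E2 → ℝ} {M : ℝ} {j : E2 → E2} {τ τ₁ : ℝ}
  {P : Finset (Finset E2)} {c : Finset E2 → E2} {D : Finset E2 → Set E2}

theorem one_le_card (hP : IsClusterConfig U Λ M j τ P c D) {S : Finset E2} (hS : S ∈ P) :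
    (1 : ℝ) ≤ S.card :=
  Nat.one_le_cast.2 (hP.nonempty S hS).card_pos

theorem lt_dist_of_notMem (hP : IsClusterConfig U Λ M j τ P c D) (hτ : τ ≤ τ₁)
    (hsep : ∀ S ∈ P, ∀ T ∈ P, S ≠ T → (S.card + T.card) * τ₁ ≤ dist (c S) (c T))
    {S : Finset E2} (hS : S ∈ P) {p : E2} (hp : p ∈ Λ) (hpS : p ∉ S) :
    (S.card + 1) * τ₁ ≤ dist p (c S) := by
  obtain ⟨T, hT, hpT⟩ := hP.cover p hp
  have h1 := hsep S hS T hT fun h => hpS (h ▸ hpT)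
  have h2 := hP.dist_center_le T hT p hpT
  have h3 := mul_le_mul_of_nonneg_left hτ (sub_nonneg.2 (hP.one_le_card hT))
  have h4 := dist_triangle_left (c S) (c T) p
  linarith

theorem grow (h : IsVortexField U Λ m M j) (hM : 0 ≤ M)
    (hP : IsClusterConfig U Λ M j τ P c D) (hτ0 : 0 ≤ τ) (hτ : τ < τ₁)
    (hsep : ∀ S ∈ P, ∀ T ∈ P, S ≠ T → (S.card + T.card) * τ₁ ≤ dist (c S) (c T)) :
    IsClusterConfig U Λ M j τ₁ P c fun S => ball (c S) (S.card * τ₁) where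
  subset := hP.subset
  nonempty := hP.nonempty
  disjoint := hP.disjoint
  cover := hP.cover
  dist_center_le S hS p hp := (hP.dist_center_le S hS p hp).trans
    (mul_le_mul_of_nonneg_left hτ.le (sub_nonneg.2 (hP.one_le_card hS)))
  measurableSet S _ := measurableSet_ball
  subset_closedBall S _ := ball_subset_closedBall
  pairwiseDisjoint S hS T hT hST :=
    ball_disjoint_ball (by have := hsep S hS T hT hST; linarith)
  gain_le S hS χ K hχ0 hχ hχU η hη hητ := by
    have hd := hP.one_le_card hS
    have hτ1 : 0 < τ₁ := hτ0.trans_lt hτ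
    set V := ⋃ p ∈ Λ, ball p η with hV
    have hVm : MeasurableSet V := (isOpen_biUnion fun _ _ => isOpen_ball).measurableSet
    have hann : ∀ σ, η ≤ σ → τ ≤ σ → σ ≤ τ₁ →
        vortexGain χ S Λ.card M K σ τ₁ ≤
          ∫ x in ball (c S) (S.card * τ₁) \ closedBall (c S) (S.card * σ), χ x * ‖j x‖ ^ 2 ∧
        ball (c S) (S.card * τ₁) \ closedBall (c S) (S.card * σ) ⊆
          ball (c S) (S.card * τ₁) \ V := fun σ hησ hτσ hσ => by
      have hσ0 : 0 < σ := hη.trans_le hησ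
      refine ⟨h.integral_annulus_ge hM hσ0 hσ (hP.subset S hS) (hP.nonempty S hS)
        (fun p hp => ?_) (fun p hp hpS => ?_) hχ0 hχ hχU, fun x hx => ⟨hx.1, fun hxV => hx.2 ?_⟩⟩
      · have h1 := hP.dist_center_le S hS p hp
        have h2 := mul_le_mul_of_nonneg_left hτσ (sub_nonneg.2 hd)
        linarith
      · have := hP.lt_dist_of_notMem hτ.le hsep hS hp hpS
        linarith
      · simp only [hV, mem_iUnion, mem_ball, exists_prop] at hxV
        obtain ⟨p, hp, hxp⟩ := hxV
        rw [mem_closedBall]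
        have h3 := dist_triangle x p (c S)
        by_cases hpS : p ∈ S
        · have h1 := hP.dist_center_le S hS p hpS
          have h2 := mul_le_mul_of_nonneg_left hτσ (sub_nonneg.2 hd)
          linarith
        · have h1 := hP.lt_dist_of_notMem hτ.le hsep hS hp hpS
          have h2 := dist_triangle_left p (c S) x
          have h4 := mem_ball.1 hx.1
          linarith
    have hint : IntegrableOn (fun x => χ x * ‖j x‖ ^ 2) (ball (c S) (S.card * τ₁) \ V) :=
      h.integrableOn_perforated hχ.continuous hχU measurableSet_ball ball_subset_closedBall hη
    have hnn : 0 ≤ᵐ[volume.restrict (ball (c S) (S.card * τ₁) \ V)]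
        fun x => χ x * ‖j x‖ ^ 2 :=
      Eventually.of_forall fun x => mul_nonneg (hχ0 x) (sq_nonneg _)
    rcases le_total η τ with hητ' | hητ'
    · obtain ⟨h1, h2⟩ := hann τ hητ' le_rfl hτ.le
      have hsub : closedBall (c S) (S.card * τ) ⊆ ball (c S) (S.card * τ₁) :=
        closedBall_subset_ball (mul_lt_mul_of_pos_left hτ (by linarith))
      have hDsub : D S \ V ⊆ ball (c S) (S.card * τ₁) \ V :=
        sdiff_subset_sdiff_left ((hP.subset_closedBall S hS).trans hsub)
      have h3 := hP.gain_le S hS χ K hχ0 hχ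
        (fun x hx => hχU ⟨hx.1, ball_subset_closedBall (hsub hx.2)⟩) η hη hητ'
      have hdisj : Disjoint (D S \ V)
          (ball (c S) (S.card * τ₁) \ closedBall (c S) (S.card * τ)) :=
        disjoint_left.2 fun x hx hx' => hx'.2 (hP.subset_closedBall S hS hx.1)
      have h4 := setIntegral_union hdisj (measurableSet_ball.diff measurableSet_closedBall)
        (hint.mono_set hDsub) (hint.mono_set h2)
      have h5 := setIntegral_mono_set hint hnn (union_subset hDsub h2).eventuallyLE
      have h6 : vortexGain χ S Λ.card M K η τ₁ =
          vortexGain χ S Λ.card M K η τ + vortexGain χ S Λ.card M K τ τ₁ := by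
        simp only [vortexGain]; ring
      linarith
    · obtain ⟨h1, h2⟩ := hann η le_rfl hητ' hητ
      exact h1.trans (setIntegral_mono_set hint hnn h2.eventuallyLE)

theorem merge (h : IsVortexField U Λ m M j) (hP : IsClusterConfig U Λ M j τ P c D) (hτ0 : 0 ≤ τ)
    {S T : Finset E2} (hS : S ∈ P) (hT : T ∈ P) (hST : S ≠ T)
    (hdist : dist (c S) (c T) ≤ (S.card + T.card) * τ) :
    ∃ P' c' D', IsClusterConfig U Λ M j τ P' c' D' ∧ P'.card < P.card := by
  classical
  have hdS := hP.one_le_card hS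
  have hdT := hP.one_le_card hT
  have hdisj : Disjoint S T := hP.disjoint hS hT hST
  have hcard : ((S ∪ T).card : ℝ) = S.card + T.card := by
    rw [Finset.card_union_of_disjoint hdisj, Nat.cast_add]
  obtain ⟨c₀, hc₀S, hc₀T⟩ : ∃ c₀, dist (c S) c₀ ≤ T.card * τ ∧ dist (c T) c₀ ≤ S.card * τ := by
    have hpos : (0 : ℝ) < S.card + T.card := by linarith
    refine ⟨AffineMap.lineMap (c S) (c T) ((T.card : ℝ) / (S.card + T.card)), ?_, ?_⟩
    · rw [dist_left_lineMap, Real.norm_of_nonneg (by positivity), div_mul_eq_mul_div,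
        div_le_iff₀ hpos]
      calc _ ≤ (T.card : ℝ) * ((S.card + T.card) * τ) := by gcongr
        _ = _ := by ring
    · rw [dist_right_lineMap, show (1 : ℝ) - T.card / (S.card + T.card) =
        S.card / (S.card + T.card) by field_simp; ring,
        Real.norm_of_nonneg (by positivity), div_mul_eq_mul_div, div_le_iff₀ hpos]
      calc _ ≤ (S.card : ℝ) * ((S.card + T.card) * τ) := by gcongr
        _ = _ := by ring
  have hballS : closedBall (c S) (S.card * τ) ⊆ closedBall c₀ ((S ∪ T).card * τ) :=
    closedBall_subset_closedBall' (by rw [hcard]; linarith)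
  have hballT : closedBall (c T) (T.card * τ) ⊆ closedBall c₀ ((S ∪ T).card * τ) :=
    closedBall_subset_closedBall' (by rw [hcard]; linarith)
  set Q := (P.erase S).erase T with hQ
  have hQP : ∀ R ∈ Q, R ∈ P ∧ R ≠ S ∧ R ≠ T := fun R hR => by
    simp only [hQ, Finset.mem_erase] at hR
    exact ⟨hR.2.2, hR.2.1, hR.1⟩
  have hQne : ∀ R ∈ Q, R ≠ S ∪ T := fun R hR hRST => by
    obtain ⟨p, hp⟩ := hP.nonempty S hS
    obtain ⟨h1, h2, -⟩ := hQP R hR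
    exact Finset.disjoint_left.1 (hP.disjoint h1 hS h2) (hRST ▸ Finset.mem_union_left T hp) hp
  have hQsub : (Q : Set (Finset E2)) ⊆ P := fun R hR => (hQP R hR).1
  have hupd : ∀ {α : Type} (f : Finset E2 → α) (a : α), ∀ R ∈ Q,
      Function.update f (S ∪ T) a R = f R := fun f a R hR => Function.update_of_ne (hQne R hR) _ _
  refine ⟨insert (S ∪ T) Q, Function.update c (S ∪ T) c₀,
    Function.update D (S ∪ T) (D S ∪ D T), ?_, ?_⟩
  · constructor
    · simp only [Finset.forall_mem_insert]
      exact ⟨Finset.union_subset (hP.subset S hS) (hP.subset T hT),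
        fun R hR => hP.subset R (hQP R hR).1⟩
    · simp only [Finset.forall_mem_insert]
      exact ⟨(hP.nonempty S hS).mono Finset.subset_union_left,
        fun R hR => hP.nonempty R (hQP R hR).1⟩
    · rw [Finset.coe_insert, pairwiseDisjoint_insert]
      refine ⟨hP.disjoint.subset hQsub, fun R hR _ => ?_⟩
      obtain ⟨h1, h2, h3⟩ := hQP R hR
      exact Finset.disjoint_union_left.2
        ⟨hP.disjoint hS h1 h2.symm, hP.disjoint hT h1 h3.symm⟩
    · intro p hp
      obtain ⟨R, hR, hpR⟩ := hP.cover p hp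
      by_cases hRS : R = S
      · exact ⟨S ∪ T, Finset.mem_insert_self _ _, Finset.mem_union_left T (hRS ▸ hpR)⟩
      by_cases hRT : R = T
      · exact ⟨S ∪ T, Finset.mem_insert_self _ _, Finset.mem_union_right S (hRT ▸ hpR)⟩
      · exact ⟨R, Finset.mem_insert_of_mem (by simp [hQ, hRS, hRT, hR]), hpR⟩
    · rw [Finset.forall_mem_insert]
      refine ⟨fun p hp => ?_, fun R hR p hp => ?_⟩
      · rw [Function.update_self, hcard]
        rcases Finset.mem_union.1 hp with hp | hp
        · have h1 := hP.dist_center_le S hS p hp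
          have h2 := dist_triangle p (c S) c₀
          linarith
        · have h1 := hP.dist_center_le T hT p hp
          have h2 := dist_triangle p (c T) c₀
          linarith
      · rw [hupd c c₀ R hR]
        exact hP.dist_center_le R (hQP R hR).1 p hp
    · rw [Finset.forall_mem_insert]
      refine ⟨?_, fun R hR => ?_⟩
      · rw [Function.update_self]
        exact (hP.measurableSet S hS).union (hP.measurableSet T hT)
      · rw [hupd D _ R hR]
        exact hP.measurableSet R (hQP R hR).1
    · rw [Finset.forall_mem_insert]
      refine ⟨?_, fun R hR => ?_⟩
      · rw [Function.update_self, Function.update_self]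
        exact union_subset ((hP.subset_closedBall S hS).trans hballS)
          ((hP.subset_closedBall T hT).trans hballT)
      · rw [hupd D _ R hR, hupd c _ R hR]
        exact hP.subset_closedBall R (hQP R hR).1
    · rw [Finset.coe_insert, pairwiseDisjoint_insert]
      refine ⟨fun R hR R' hR' hne => ?_, fun R hR _ => ?_⟩
      · rw [Function.onFun, hupd D _ R hR, hupd D _ R' hR']
        exact hP.pairwiseDisjoint (hQsub hR) (hQsub hR') hne
      · obtain ⟨h1, h2, h3⟩ := hQP R hR
        rw [Function.update_self, hupd D _ R hR]
        exact disjoint_union_left.2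
          ⟨hP.pairwiseDisjoint hS h1 h2.symm, hP.pairwiseDisjoint hT h1 h3.symm⟩
    · rw [Finset.forall_mem_insert]
      refine ⟨fun χ K hχ0 hχ hχU η hη hητ => ?_, fun R hR => ?_⟩
      · rw [Function.update_self] at hχU ⊢
        have hUS : tsupport χ ∩ closedBall (c S) (S.card * τ) ⊆ U :=
          (inter_subset_inter_right _ hballS).trans hχU
        have hUT : tsupport χ ∩ closedBall (c T) (T.card * τ) ⊆ U :=
          (inter_subset_inter_right _ hballT).trans hχU
        have h1 := hP.gain_le S hS χ K hχ0 hχ hUS η hη hητ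
        have h2 := hP.gain_le T hT χ K hχ0 hχ hUT η hη hητ
        have hVm : MeasurableSet (⋃ p ∈ Λ, ball p η) :=
          (isOpen_biUnion fun _ _ => isOpen_ball).measurableSet
        rw [union_sdiff_distrib, setIntegral_union
          ((hP.pairwiseDisjoint hS hT hST).mono sdiff_subset sdiff_subset)
          ((hP.measurableSet T hT).diff hVm)
          (h.integrableOn_perforated hχ.continuous hUS (hP.measurableSet S hS)
            (hP.subset_closedBall S hS) hη)
          (h.integrableOn_perforated hχ.continuous hUT (hP.measurableSet T hT)
            (hP.subset_closedBall T hT) hη)]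
        have h3 : vortexGain χ (S ∪ T) Λ.card M K η τ =
            vortexGain χ S Λ.card M K η τ + vortexGain χ T Λ.card M K η τ := by
          simp only [vortexGain, hcard, Finset.sum_union hdisj]; ring
        linarith
      · rw [hupd D _ R hR, hupd c _ R hR]
        exact hP.gain_le R (hQP R hR).1
  · have h1 := Finset.card_insert_le (S ∪ T) Q
    have h2 : Q.card + 1 = (P.erase S).card :=
      Finset.card_erase_add_one (Finset.mem_erase.2 ⟨hST.symm, hT⟩)
    have h3 := Finset.card_erase_add_one hS
    omega

theorem exists_separated (h : IsVortexField U Λ m M j) (hM : 0 ≤ M) {τ' : ℝ} (n : ℕ) :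
    ∀ {τ : ℝ} {P : Finset (Finset E2)} {c : Finset E2 → E2} {D : Finset E2 → Set E2},
      IsClusterConfig U Λ M j τ P c D → 0 ≤ τ → τ ≤ τ' → P.card ≤ n →
      ∃ P' c' D', IsClusterConfig U Λ M j τ' P' c' D' ∧
        ∀ S ∈ P', ∀ T ∈ P', S ≠ T → (S.card + T.card) * τ' < dist (c' S) (c' T) := by
  classical
  induction n with
  | zero =>
    intro τ P c D hP hτ0 hτ hcard
    obtain rfl : P = ∅ := Finset.card_eq_zero.1 (Nat.le_zero.1 hcard)
    refine ⟨∅, c, D, ⟨by simp, by simp, by simp, hP.cover, by simp, by simp, by simp, by simp,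
      by simp⟩, by simp⟩
  | succ n ih =>
    intro τ P c D hP hτ0 hτ hcard
    by_cases hsep : ∀ S ∈ P, ∀ T ∈ P, S ≠ T → (S.card + T.card) * τ' < dist (c S) (c T)
    · rcases hτ.eq_or_lt with rfl | hlt
      · exact ⟨P, c, D, hP, hsep⟩
      · exact ⟨P, c, _, grow h hM hP hτ0 hlt fun S hS T hT hST => (hsep S hS T hT hST).le, hsep⟩
    push Not at hsep
    obtain ⟨S, hS, T, hT, hST, hle⟩ := hsep
    obtain ⟨⟨S₁, T₁⟩, hmem, hmin⟩ := P.offDiag.exists_min_image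
      (fun q => dist (c q.1) (c q.2) / ((q.1.card : ℝ) + q.2.card))
      ⟨(S, T), Finset.mem_offDiag.2 ⟨hS, hT, hST⟩⟩
    obtain ⟨hS₁, hT₁, hST₁⟩ := Finset.mem_offDiag.1 hmem
    simp only at hS₁ hT₁ hST₁ hmin
    have hpos : ∀ R ∈ P, ∀ R' ∈ P, (0 : ℝ) < R.card + R'.card := fun R hR R' hR' => by
      linarith [hP.one_le_card hR, hP.one_le_card hR']
    set σ := dist (c S₁) (c T₁) / ((S₁.card : ℝ) + T₁.card) with hσ
    have hσdist : dist (c S₁) (c T₁) = (S₁.card + T₁.card) * σ := by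
      rw [hσ, mul_div_cancel₀ _ (hpos S₁ hS₁ T₁ hT₁).ne']
    have hσ' : σ ≤ τ' := (hmin (S, T) (Finset.mem_offDiag.2 ⟨hS, hT, hST⟩)).trans
      ((div_le_iff₀ (hpos S hS T hT)).2 (by linarith))
    rcases le_or_gt σ τ with hστ | hστ
    · obtain ⟨P', c', D', hP', hlt⟩ := merge h hP hτ0 hS₁ hT₁ hST₁
        (hσdist.trans_le (mul_le_mul_of_nonneg_left hστ (hpos S₁ hS₁ T₁ hT₁).le))
      exact ih hP' hτ0 hτ (by omega)
    · have hP₁ := grow h hM hP hτ0 hστ fun R hR R' hR' hne => by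
        have := hmin (R, R') (Finset.mem_offDiag.2 ⟨hR, hR', hne⟩)
        rw [le_div_iff₀ (hpos R hR R' hR')] at this
        linarith
      obtain ⟨P', c', D', hP', hlt⟩ := merge h hP₁ (hτ0.trans hστ.le) hS₁ hT₁ hST₁ hσdist.le
      exact ih hP' (hτ0.trans hστ.le) hσ' (by omega)

theorem exists_singletons (U : Set E2) (Λ : Finset E2) (M : ℝ) (j : E2 → E2) :
    ∃ P c D, IsClusterConfig U Λ M j 0 P c D := by
  classical
  let c : Finset E2 → E2 := fun S => if h : S.Nonempty then h.choose else 0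
  have hc : ∀ p, c {p} = p := fun p => by
    have h : ({p} : Finset E2).Nonempty := Finset.singleton_nonempty p
    simpa only [c, dif_pos h] using Finset.mem_singleton.1 h.choose_spec
  refine ⟨Λ.image fun p => {p}, c, fun _ => ∅, ?_⟩
  constructor
  · simp
  · simp
  · intro S hS T hT hST
    simp only [Finset.coe_image, mem_image] at hS hT
    obtain ⟨p, -, rfl⟩ := hS
    obtain ⟨q, -, rfl⟩ := hT
    exact Finset.disjoint_singleton.2 fun h => hST (h ▸ rfl)
  · simp
  · simp [hc]
  · simp
  · simp
  · exact fun _ _ _ _ _ => disjoint_bot_left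
  · intro S _ χ K _ _ _ η hη hη'
    exact absurd hη' hη.not_ge

end IsClusterConfig

theorem IsClusterConfig.vortexGain_le_integral_closedBall {U : Set E2} {Λ : Finset E2}
    {m : E2 → ℝ} {M : ℝ} {j : E2 → E2} {τ : ℝ} {P : Finset (Finset E2)} {c : Finset E2 → E2}
    {D : Finset E2 → Set E2} (h : IsVortexField U Λ m M j)
    (hP : IsClusterConfig U Λ M j τ P c D) {S : Finset E2} (hS : S ∈ P) {χ : E2 → ℝ} {K : NNReal}
    (hχ0 : ∀ x, 0 ≤ χ x) (hχ : LipschitzWith K χ)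
    (hχU : tsupport χ ∩ closedBall (c S) (S.card * τ) ⊆ U) {η : ℝ} (hη : 0 < η) (hητ : η ≤ τ) :
    vortexGain χ S Λ.card M K η τ ≤
      ∫ x in closedBall (c S) (S.card * τ) \ ⋃ p ∈ Λ, ball p η, χ x * ‖j x‖ ^ 2 :=
  (hP.gain_le S hS χ K hχ0 hχ hχU η hη hητ).trans <| setIntegral_mono_set
    (h.integrableOn_perforated hχ.continuous hχU measurableSet_closedBall subset_rfl hη)
    (Eventually.of_forall fun x => mul_nonneg (hχ0 x) (sq_nonneg _))
    (sdiff_subset_sdiff_left (hP.subset_closedBall S hS)).eventuallyLE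

theorem le_vortexGain {χ : E2 → ℝ} (hχ : ∀ x, 0 ≤ χ x) {S : Finset E2} {N M K r η : ℝ}
    (hN : 0 < N) (hM : 0 ≤ M) (hK : 0 ≤ K) (hr : 0 < r) (hη : 0 < η) :
    2 * Real.pi * (Real.log (r / (N * η)) - M * r ^ 2 / 2) * ∑ p ∈ S, χ p -
        4 * Real.pi * r * S.card * K ≤ vortexGain χ S N M K η (r / N) := by
  have hlog : Real.log (r / (N * η)) = Real.log (r / N) - Real.log η := by
    rw [← div_div, Real.log_div (div_pos hr hN).ne' hη.ne']
  have hsq : N ^ 2 * M * ((r / N) ^ 2 - η ^ 2) = M * r ^ 2 - N ^ 2 * M * η ^ 2 := by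
    field_simp
  have hlin : N * K * S.card * (r / N - η) = K * S.card * r - N * K * S.card * η := by
    field_simp
  have h1 : 0 ≤ (∑ p ∈ S, χ p) * (N ^ 2 * M * η ^ 2) :=
    mul_nonneg (Finset.sum_nonneg fun p _ => hχ p) (by positivity)
  have h2 : 0 ≤ N * K * S.card * η := by positivity
  have key : vortexGain χ S N M K η (r / N) -
      (2 * Real.pi * (Real.log (r / (N * η)) - M * r ^ 2 / 2) * ∑ p ∈ S, χ p -
        4 * Real.pi * r * S.card * K) =
      Real.pi * ((∑ p ∈ S, χ p) * (N ^ 2 * M * η ^ 2) + 4 * (N * K * S.card * η)) := by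
    rw [vortexGain, hsq, hlog]
    linear_combination (-4 * Real.pi) * hlin
  have := mul_nonneg Real.pi_pos.le (add_nonneg h1 (mul_nonneg zero_le_four h2))
  linarith

theorem IsVortexField.bound_nonneg {U : Set E2} {Λ : Finset E2} {m : E2 → ℝ} {M : ℝ}
    {j : E2 → E2} (h : IsVortexField U Λ m M j) (hU : U.Nonempty) : 0 ≤ M := by
  have : NeBot (ae (volume.restrict U)) := by
    rw [ae_neBot, Ne, Measure.restrict_eq_zero]
    exact (h.isOpen.measure_pos volume hU).ne'
  obtain ⟨x, hx⟩ := h.bound.exists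
  exact (abs_nonneg _).trans hx

end

/-- Proposition 4.6 (ball construction à la Jerrard–Sandier), items three and four,
for a fixed total radius `r`. The distributional relation `curl j = 2π Σ_{p∈Λ} δ_p − m`
is expressed by testing against smooth compactly supported functions. -/
theorem stmt7
    (U : Set E2) (hU : IsOpen U)
    (Λ : Finset E2) (hΛU : (Λ : Set E2) ⊆ U) (hΛne : Λ.Nonempty)
    (m : E2 → ℝ) (M : ℝ)
    (hm : ∀ᵐ x ∂(volume.restrict U), |m x| ≤ M)
    (hmi : LocallyIntegrableOn m U volume)
    (j : E2 → E2)
    (hj1 : LocallyIntegrableOn j U volume)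
    (hj2 : LocallyIntegrableOn (fun x => ‖j x‖ ^ 2) (U \ (Λ : Set E2)) volume)
    (hcurl : ∀ φ : E2 → ℝ, ContDiff ℝ (⊤ : ℕ∞) φ → HasCompactSupport φ → tsupport φ ⊆ U →
      -∫ x in U, (-(j x 0) * fderiv ℝ φ x (EuclideanSpace.single 1 1) +
          j x 1 * fderiv ℝ φ x (EuclideanSpace.single 0 1)) ∂volume =
        2 * Real.pi * ∑ p ∈ Λ, φ p - ∫ x in U, m x * φ x ∂volume)
    (r : ℝ) (hr0 : 0 < r) (hr1 : r ≤ 1) :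
    ∃ B : Finset (E2 × ℝ),
      (∀ b ∈ B, 0 < b.2) ∧
      ((B : Set (E2 × ℝ)).Pairwise fun b b' =>
        Disjoint (closedBall b.1 b.2) (closedBall b'.1 b'.2)) ∧
      ((Λ : Set E2) ⊆ ⋃ b ∈ B, closedBall b.1 b.2) ∧
      (∑ b ∈ B, b.2 = r) ∧
      (∀ b ∈ B, closedBall b.1 b.2 ⊆ U → ∀ η : ℝ, 0 < η → η ≤ r / (Λ.card : ℝ) →
        Real.pi * (((Λ : Set E2) ∩ closedBall b.1 b.2).ncard : ℝ) *
            (Real.log (r / ((Λ.card : ℝ) * η)) - M * r ^ 2 / 2) ≤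
          (1 / 2) * ∫ x in closedBall b.1 b.2 \ ⋃ p ∈ Λ, ball p η, ‖j x‖ ^ 2 ∂volume) ∧
      (∀ b ∈ B, ∀ χ : E2 → ℝ, (∀ x, 0 ≤ χ x) → HasCompactSupport χ → tsupport χ ⊆ U →
        ∀ K : NNReal, LipschitzWith K χ → ∀ η : ℝ, 0 < η → η ≤ r / (Λ.card : ℝ) →
          -(4 * Real.pi * r * (((Λ : Set E2) ∩ closedBall b.1 b.2).ncard : ℝ) * (K : ℝ)) ≤
            (∫ x in closedBall b.1 b.2 \ ⋃ p ∈ Λ, ball p η, χ x * ‖j x‖ ^ 2 ∂volume) -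
              2 * Real.pi * (Real.log (r / ((Λ.card : ℝ) * η)) - M * r ^ 2 / 2) *
                ∑ p ∈ Λ, Set.indicator (closedBall b.1 b.2) χ p) := by
  classical
  have h : IsVortexField U Λ m M j := ⟨hU, hm, hmi, hj1, hj2, hcurl⟩
  have hM : 0 ≤ M := h.bound_nonneg (hΛne.to_set.mono hΛU)
  have hN : (0 : ℝ) < Λ.card := Nat.cast_pos.2 hΛne.card_pos
  have hτ : 0 < r / Λ.card := div_pos hr0 hN
  obtain ⟨P₀, c₀, D₀, hP₀⟩ := IsClusterConfig.exists_singletons U Λ M j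
  obtain ⟨P, c, D, hP, hsep⟩ :=
    IsClusterConfig.exists_separated h hM P₀.card hP₀ le_rfl hτ.le le_rfl
  have hdisj : ∀ S ∈ P, ∀ T ∈ P, S ≠ T → Disjoint
      (closedBall (c S) (S.card * (r / Λ.card))) (closedBall (c T) (T.card * (r / Λ.card))) :=
    fun S hS T hT hST => closedBall_disjoint_closedBall (by linarith [hsep S hS T hT hST])
  have hmem : ∀ S ∈ P, ∀ p ∈ S, p ∈ closedBall (c S) (S.card * (r / Λ.card)) :=
    fun S hS p hp => (hP.dist_center_le S hS p hp).trans (by linarith)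
  have hinter : ∀ S ∈ P, (Λ : Set E2) ∩ closedBall (c S) (S.card * (r / Λ.card)) = S := by
    intro S hS
    ext p
    refine ⟨fun ⟨hpΛ, hpS⟩ => ?_, fun hpS => ⟨hP.subset S hS hpS, hmem S hS p hpS⟩⟩
    obtain ⟨T, hT, hpT⟩ := hP.cover p hpΛ
    by_cases hST : S = T
    · exact hST ▸ hpT
    · exact (Set.disjoint_left.1 (hdisj S hS T hT hST) hpS (hmem T hT p hpT)).elim
  have hindicator : ∀ S ∈ P, ∀ χ : E2 → ℝ,
      ∑ p ∈ Λ, (closedBall (c S) (S.card * (r / Λ.card))).indicator χ p = ∑ p ∈ S, χ p := by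
    intro S hS χ
    rw [← Finset.sum_subset (hP.subset S hS)]
    · exact Finset.sum_congr rfl fun p hp => Set.indicator_of_mem (hmem S hS p hp) χ
    · exact fun p hpΛ hpS => Set.indicator_of_notMem
        (fun hp => hpS (Finset.mem_coe.1 ((hinter S hS).subset ⟨hpΛ, hp⟩))) χ
  have hinj : Set.InjOn (fun S : Finset E2 => (c S, (S.card : ℝ) * (r / Λ.card))) P := by
    intro S hS T hT hST
    by_contra hne
    have h1 := hsep S hS T hT hne
    rw [(Prod.mk.inj hST).1, dist_self] at h1
    exact h1.not_ge (by positivity)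
  have hsum : ∑ S ∈ P, S.card = Λ.card := by
    refine (Finset.card_biUnion (t := id) fun S hS T hT hST =>
      hP.disjoint hS hT hST).symm.trans (congrArg Finset.card ?_)
    ext p
    rw [Finset.mem_biUnion]
    exact ⟨fun ⟨S, hS, hp⟩ => hP.subset S hS hp, hP.cover p⟩
  refine ⟨P.image fun S => (c S, S.card * (r / Λ.card)), ?_, ?_, ?_, ?_, ?_, ?_⟩
  · rw [Finset.forall_mem_image]
    exact fun S hS => mul_pos (zero_lt_one.trans_le (hP.one_le_card hS)) hτ
  · rw [Finset.coe_image, hinj.pairwise_image]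
    exact fun S hS T hT hST => hdisj S hS T hT hST
  · intro p hp
    obtain ⟨S, hS, hpS⟩ := hP.cover p hp
    exact Set.mem_biUnion (Finset.mem_image_of_mem _ hS) (hmem S hS p hpS)
  · rw [Finset.sum_image hinj, ← Finset.sum_mul, ← Nat.cast_sum, hsum, mul_div_cancel₀ _ hN.ne']
  · rw [Finset.forall_mem_image]
    intro S hS hSU η hη hητ
    have h1 := hP.vortexGain_le_integral_closedBall h hS (χ := fun _ => 1)
      (fun _ => zero_le_one) (LipschitzWith.const 1) (Set.inter_subset_right.trans hSU) hη hητ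
    have h2 := le_vortexGain (χ := fun _ => 1) (S := S) (fun _ => zero_le_one) hN hM le_rfl hr0 hη
    simp only [one_mul, Finset.sum_const, nsmul_eq_mul, mul_one, mul_zero, sub_zero,
      NNReal.coe_zero] at h1 h2
    dsimp only
    rw [hinter S hS, Set.ncard_coe_finset]
    linarith
  · rw [Finset.forall_mem_image]
    intro S hS χ hχ0 _ hχU K hχ η hη hητ
    have h1 := hP.vortexGain_le_integral_closedBall h hS hχ0 hχ
      (Set.inter_subset_left.trans hχU) hη hητ
    have h2 := le_vortexGain (S := S) hχ0 hN hM K.coe_nonneg hr0 hη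
    dsimp only
    rw [hinter S hS, hindicator S hS, Set.ncard_coe_finset]
    linarith
end

section
/- Let j ∈ L^p_loc(ℝ², ℝ²) for some p > 1, and assume j belongs to the admissible class 𝒜_1: there is a locally finite set Λ ⊂ ℝ² such that, with ν = 2π Σ_{p∈Λ} δ_p, one has div j = 0 and curl j = ν − 1 distributionally in ℝ², and sup_{R>1} ν(B_R)/|B_R| < ∞. Let (U_R)_{R>0} be a family of bounded open subsets of ℝ², increasing in R, for which there exist constants C₀ ≥ 1 and θ ∈ (0,2) with: U_R + B(0,1) ⊆ U_{R+C₀}, U_{R+1} ⊆ U_R + B(0,C₀), and |U_{R+1} ∖ U_R| ≤ C₀ R^θ for all R > 0. Then there exists C > 0, depending only on C₀ and θ, such that for every R > C: max{ |ν(U_R) − |U_R||, ν(Û_R) − ν(U_R) } ≤ C (R^θ + R^{θ(1−1/p)}) ( ‖j‖_{L^p(U_{R+C})} + 1 ), where Û_R = {x ∈ ℝ² : dist(x, U_R) < 1}. -/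
open MeasureTheory Metric Filter
open scoped Pointwise

set_option maxSynthPendingDepth 3 in
theorem exists_contDiff_cutoff {E : Type*} [NormedAddCommGroup E] [InnerProductSpace ℝ E]
    [FiniteDimensional ℝ E] [MeasurableSpace E] [BorelSpace E] :
    ∃ c : ℝ, 0 ≤ c ∧ ∀ V : Set E, Bornology.IsBounded V → ∃ φ : E → ℝ,
      ContDiff ℝ (⊤ : ℕ∞) φ ∧ HasCompactSupport φ ∧ (∀ x, 0 ≤ φ x) ∧ (∀ x, φ x ≤ 1) ∧
      (∀ x ∈ V, φ x = 1) ∧ (∀ x, x ∉ thickening 1 V → φ x = 0) ∧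
      ∀ x, ‖fderiv ℝ φ x‖ ≤ c := by
  let f : ContDiffBump (0 : E) := ⟨1 / 4, 1 / 2, by norm_num, by norm_num⟩
  have hrOut : f.rOut = 1 / 2 := rfl
  let ρ : E → ℝ := f.normed volume
  have hρ : ContDiff ℝ (⊤ : ℕ∞) ρ := f.contDiff_normed
  have hρc : HasCompactSupport ρ := f.hasCompactSupport_normed
  have hρ0 (x : E) : 0 ≤ ρ x := f.nonneg_normed x
  have hρint : Integrable ρ := f.integrable_normed
  have hdρ : Integrable (fun x => ‖fderiv ℝ ρ x‖) :=
    ((hρ.continuous_fderiv (by simp)).integrable_of_hasCompactSupport (hρc.fderiv ℝ)).norm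
  let L := ContinuousLinearMap.lsmul ℝ ℝ (E := ℝ)
  refine ⟨‖L.precompL E‖ * ∫ x, ‖fderiv ℝ ρ x‖, by positivity, fun V hV => ?_⟩
  let W := thickening (1 / 2) V
  let g : E → ℝ := W.indicator 1
  have hW : IsOpen W := isOpen_thickening
  have hg : LocallyIntegrable g :=
    (locallyIntegrable_const (1 : ℝ)).indicator hW.measurableSet
  have hg0 (x : E) : 0 ≤ g x := Set.indicator_nonneg (by simp) x
  have hg1 (x : E) : g x ≤ 1 := Set.indicator_le_self' (by simp) x
  have hgn (x : E) : ‖g x‖ ≤ 1 := by rw [Real.norm_of_nonneg (hg0 x)]; exact hg1 x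
  have hzero (x : E) (hx : x ∉ thickening 1 V) : convolution ρ g L volume x = 0 := by
    have hball : ∀ y ∈ ball x f.rOut, g y = 0 := by
      intro y hy
      refine Set.indicator_of_notMem (fun hyW => hx ?_) _
      obtain ⟨z, hz, hyz⟩ := mem_thickening_iff.1 hyW
      refine mem_thickening_iff.2 ⟨z, hz, ?_⟩
      rw [mem_ball', hrOut] at hy
      linarith [dist_triangle x y z]
    have hx0 : g x = 0 := hball x (mem_ball_self f.rOut_pos)
    exact (f.normed_convolution_eq_right fun y hy => by rw [hball y hy, hx0]).trans hx0
  refine ⟨convolution ρ g L volume, hρc.contDiff_convolution_left L hρ hg, ?_, ?_, ?_, ?_, hzero,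
    ?_⟩
  · refine HasCompactSupport.of_support_subset_isCompact
      (hV.thickening (δ := 1)).isCompact_closure fun x hx => subset_closure ?_
    exact not_not.1 fun h => hx (hzero x h)
  · exact fun x => integral_nonneg fun t => mul_nonneg (hρ0 t) (hg0 _)
  · intro x
    calc convolution ρ g L volume x ≤ ∫ t, ρ t := by
          refine integral_mono_of_nonneg (.of_forall fun t => mul_nonneg (hρ0 t) (hg0 _)) hρint
            (.of_forall fun t => mul_le_of_le_one_right (hρ0 t) (hg1 _))
      _ = 1 := f.integral_normed
  · intro x hx
    have hball : ∀ y ∈ ball x f.rOut, g y = 1 := fun y hy =>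
      Set.indicator_of_mem (mem_thickening_iff.2 ⟨x, hx, hy⟩) _
    have hx1 : g x = 1 := hball x (mem_ball_self f.rOut_pos)
    exact (f.normed_convolution_eq_right fun y hy => by rw [hball y hy, hx1]).trans hx1
  · intro x
    rw [(hρc.hasFDerivAt_convolution_left L (hρ.of_le (by simp)) hg x).fderiv, convolution_def,
      ← integral_const_mul]
    refine norm_integral_le_of_norm_le (hdρ.const_mul _) (.of_forall fun t => ?_)
    calc _ ≤ ‖L.precompL E‖ * ‖fderiv ℝ ρ t‖ * ‖g (x - t)‖ := ContinuousLinearMap.le_opNorm₂ _ _ _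
      _ ≤ _ := mul_le_of_le_one_right (by positivity) (hgn _)

theorem setIntegral_norm_le_Lp_mul_measureReal {α F : Type*} [MeasurableSpace α]
    [NormedAddCommGroup F] {μ : Measure α} {f : α → F} {p : ℝ} (hp : 1 < p) {A : Set α}
    (hA : μ A ≠ ⊤) (hf : MemLp f (ENNReal.ofReal p) (μ.restrict A)) :
    ∫ x in A, ‖f x‖ ∂μ ≤ (∫ x in A, ‖f x‖ ^ p ∂μ) ^ (1 / p) * μ.real A ^ (1 - 1 / p) := by
  have hpq := Real.HolderConjugate.conjExponent hp
  have : IsFiniteMeasure (μ.restrict A) := isFiniteMeasure_restrict.2 hA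
  have h := integral_mul_le_Lp_mul_Lq_of_nonneg hpq (μ := μ.restrict A) (f := fun x => ‖f x‖)
    (g := fun _ => 1) (.of_forall fun x => norm_nonneg _) (.of_forall fun _ => zero_le_one)
    hf.norm (memLp_const 1)
  have hq : 1 / p.conjExponent = 1 - 1 / p := by
    simpa using hpq.one_sub_inv.symm
  simpa [hq] using h

theorem ncard_inter_le_tsum_and_le {α : Type*} {Λ V B : Set α} (hVB : V ⊆ B)
    (hfin : (Λ ∩ B).Finite) {φ : α → ℝ} (hφ0 : ∀ x, 0 ≤ φ x) (hφ1 : ∀ x, φ x ≤ 1)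
    (hV : ∀ x ∈ V, φ x = 1) (hB : ∀ x, x ∉ B → φ x = 0) :
    ((Λ ∩ V).ncard : ℝ) ≤ ∑' q : Λ, φ q ∧ ∑' q : Λ, φ q ≤ (Λ ∩ B).ncard := by
  classical
  have hfinV : (Λ ∩ V).Finite := hfin.subset (Set.inter_subset_inter_right _ hVB)
  have hsum : ∑' q : Λ, φ q = ∑ q ∈ hfin.toFinset, φ q := by
    rw [tsum_subtype Λ φ, tsum_eq_sum (s := hfin.toFinset)]
    · refine Finset.sum_congr rfl fun q hq => Set.indicator_of_mem ?_ _
      exact ((hfin.mem_toFinset).1 hq).1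
    · intro q hq
      by_cases hqΛ : q ∈ Λ
      · rw [Set.indicator_of_mem hqΛ]
        exact hB q fun h => hq (hfin.mem_toFinset.2 ⟨hqΛ, h⟩)
      · exact Set.indicator_of_notMem hqΛ _
  rw [hsum, Set.ncard_eq_toFinset_card _ hfin, Set.ncard_eq_toFinset_card _ hfinV]
  constructor
  · calc ((hfinV.toFinset.card : ℕ) : ℝ) = ∑ q ∈ hfinV.toFinset, φ q := by
          rw [Finset.sum_congr rfl fun q hq => hV q ((hfinV.mem_toFinset).1 hq).2]
          simp
      _ ≤ _ := Finset.sum_le_sum_of_subset_of_nonneg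
          (Set.Finite.toFinset_subset_toFinset.2 (Set.inter_subset_inter_right _ hVB))
          fun q _ _ => hφ0 q
  · simpa using Finset.sum_le_card_nsmul hfin.toFinset φ 1 fun q _ => hφ1 q

theorem measureReal_le_integral_and_le {α : Type*} [MeasurableSpace α] {μ : Measure α}
    {V B : Set α} (hV : MeasurableSet V) (hB : MeasurableSet B) (hVtop : μ V ≠ ⊤)
    (hBtop : μ B ≠ ⊤) {φ : α → ℝ} (hφ : Integrable φ μ) (hφ0 : ∀ x, 0 ≤ φ x)
    (hφ1 : ∀ x, φ x ≤ 1) (hφV : ∀ x ∈ V, φ x = 1) (hφB : ∀ x, x ∉ B → φ x = 0) :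
    μ.real V ≤ ∫ x, φ x ∂μ ∧ ∫ x, φ x ∂μ ≤ μ.real B := by
  rw [← integral_indicator_one hV, ← integral_indicator_one hB]
  constructor
  · refine integral_mono ((integrable_indicator_iff hV).2 (integrableOn_const hVtop)) hφ fun x => ?_
    exact Set.indicator_le' (fun y hy => (hφV y hy).ge) (fun y _ => hφ0 y) x
  · refine integral_mono hφ ((integrable_indicator_iff hB).2 (integrableOn_const hBtop)) fun x => ?_
    by_cases hx : x ∈ B
    · simpa [hx] using hφ1 x
    · simp [hx, hφB x hx]

theorem abs_curl_integrand_le (v : E2) (T : E2 →L[ℝ] ℝ) :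
    |-(v 0) * T (EuclideanSpace.single 1 1) + v 1 * T (EuclideanSpace.single 0 1)| ≤
      2 * ‖T‖ * ‖v‖ := by
  have hT (i : Fin 2) : |T (EuclideanSpace.single i 1)| ≤ ‖T‖ := by
    simpa using T.le_opNorm (EuclideanSpace.single i 1)
  have hv (i : Fin 2) : |v i| ≤ ‖v‖ := PiLp.norm_apply_le v i
  have hmul (i k : Fin 2) : |v i| * |T (EuclideanSpace.single k 1)| ≤ ‖v‖ * ‖T‖ :=
    mul_le_mul (hv i) (hT k) (abs_nonneg _) (norm_nonneg _)
  refine (abs_add_le _ _).trans ?_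
  rw [abs_mul, abs_mul, abs_neg]
  linarith [hmul 0 1, hmul 1 0]

theorem exists_ncard_sub_volume_le :
    ∃ c : ℝ, 0 ≤ c ∧ ∀ (p : ℝ), 1 < p → ∀ (j : E2 → E2), AEStronglyMeasurable j volume →
      (∀ K : Set E2, IsCompact K → IntegrableOn (fun x => ‖j x‖ ^ p) K volume) →
      ∀ (Λ : Set E2), (∀ K : Set E2, IsCompact K → (Λ ∩ K).Finite) →
      (∀ φ : E2 → ℝ, ContDiff ℝ (⊤ : ℕ∞) φ → HasCompactSupport φ →
        -∫ x, (-(j x 0) * fderiv ℝ φ x (EuclideanSpace.single 1 1) +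
          j x 1 * fderiv ℝ φ x (EuclideanSpace.single 0 1)) =
          2 * Real.pi * (∑' q : Λ, φ q) - ∫ x, φ x) →
      ∀ V B : Set E2, IsOpen V → IsOpen B → Bornology.IsBounded B → thickening 1 V ⊆ B →
        2 * Real.pi * ((Λ ∩ V).ncard : ℝ) - volume.real B ≤
          c * (∫ x in B, ‖j x‖ ^ p) ^ (1 / p) * volume.real (B \ V) ^ (1 - 1 / p) ∧
        volume.real V - 2 * Real.pi * ((Λ ∩ B).ncard : ℝ) ≤
          c * (∫ x in B, ‖j x‖ ^ p) ^ (1 / p) * volume.real (B \ V) ^ (1 - 1 / p) := by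
  obtain ⟨c, hc, hcut⟩ := exists_contDiff_cutoff (E := E2)
  refine ⟨2 * c, by positivity, fun p hp j hj hjp Λ hΛ hcurl V B hVo hBo hB hVB => ?_⟩
  have hVB' : V ⊆ B := (self_subset_thickening one_pos V).trans hVB
  have hV := hB.subset hVB'
  obtain ⟨φ, hφ, hφc, hφ0, hφ1, hφV, hφt, hφd⟩ := hcut V hV
  have hφB : ∀ x, x ∉ B → φ x = 0 := fun x hx => hφt x fun h => hx (hVB h)
  have hd0 : ∀ x, x ∉ B \ V → fderiv ℝ φ x = 0 := by
    intro x hx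
    by_cases hxB : x ∈ B
    · have hxV : φ x = 1 := hφV x (not_not.1 fun h => hx ⟨hxB, h⟩)
      exact IsLocalMax.fderiv_eq_zero (.of_forall fun y => hxV ▸ hφ1 y)
    · exact IsLocalMin.fderiv_eq_zero (.of_forall fun y => hφB x hxB ▸ hφ0 y)
  have hjB : IntegrableOn (fun x => ‖j x‖ ^ p) B :=
    (hjp _ hB.isCompact_closure).mono_set subset_closure
  have hsub : B \ V ⊆ B := Set.sdiff_subset
  have hfinB : volume B ≠ ⊤ := hB.measure_lt_top.ne
  have hfinD : volume (B \ V) ≠ ⊤ := measure_ne_top_of_subset hsub hfinB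
  have hmem : MemLp j (ENNReal.ofReal p) (volume.restrict (B \ V)) := by
    rw [← integrable_norm_rpow_iff hj.restrict (by simpa using by linarith)
      ENNReal.ofReal_ne_top, ENNReal.toReal_ofReal (by linarith)]
    exact hjB.mono_set hsub
  have hholder := setIntegral_norm_le_Lp_mul_measureReal hp hfinD hmem
  have hjD : IntegrableOn (fun x => ‖j x‖) (B \ V) := by
    have : IsFiniteMeasure (volume.restrict (B \ V)) := isFiniteMeasure_restrict.2 hfinD
    exact (hmem.integrable (by simpa using hp.le)).norm
  have hLp : (∫ x in B \ V, ‖j x‖ ^ p) ^ (1 / p) ≤ (∫ x in B, ‖j x‖ ^ p) ^ (1 / p) := by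
    refine Real.rpow_le_rpow (by positivity) ?_ (by positivity)
    exact setIntegral_mono_set hjB (.of_forall fun x => by positivity) hsub.eventuallyLE
  have hmain : |2 * Real.pi * (∑' q : Λ, φ q) - ∫ x, φ x| ≤
      2 * c * (∫ x in B, ‖j x‖ ^ p) ^ (1 / p) * volume.real (B \ V) ^ (1 - 1 / p) := by
    rw [← hcurl φ hφ hφc, abs_neg, ← setIntegral_eq_integral_of_forall_compl_eq_zero
      (s := B \ V) fun x hx => by simp [hd0 x hx],
      ← Real.norm_eq_abs]
    calc _ ≤ ∫ x in B \ V, 2 * c * ‖j x‖ := by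
          refine norm_integral_le_of_norm_le (hjD.const_mul _) (.of_forall fun x => ?_)
          refine (abs_curl_integrand_le (j x) (fderiv ℝ φ x)).trans ?_
          have := hφd x
          gcongr
      _ = 2 * c * ∫ x in B \ V, ‖j x‖ := integral_const_mul _ _
      _ ≤ 2 * c * ((∫ x in B, ‖j x‖ ^ p) ^ (1 / p) * volume.real (B \ V) ^ (1 - 1 / p)) := by
          gcongr
          exact hholder.trans (by gcongr)
      _ = _ := by ring
  have hΛB : (Λ ∩ B).Finite :=
    (hΛ _ hB.isCompact_closure).subset (Set.inter_subset_inter_right _ subset_closure)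
  obtain ⟨hn1, hn2⟩ := ncard_inter_le_tsum_and_le hVB' hΛB hφ0 hφ1 hφV hφB
  obtain ⟨hv1, hv2⟩ := measureReal_le_integral_and_le (μ := volume) hVo.measurableSet
    hBo.measurableSet hV.measure_lt_top.ne hfinB
    (hφ.continuous.integrable_of_hasCompactSupport hφc) hφ0 hφ1 hφV hφB
  have hπ : 0 ≤ 2 * Real.pi := by positivity
  have h1 := mul_le_mul_of_nonneg_left hn1 hπ
  have h2 := mul_le_mul_of_nonneg_left hn2 hπ
  obtain ⟨ha, hb⟩ := abs_le.1 hmain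
  constructor <;> linarith

theorem measureReal_sdiff_natCast_le {α : Type*} [MeasurableSpace α] {μ : Measure α}
    {U : ℝ → Set α} {C θ : ℝ} (hθ : 0 ≤ θ) (hC : 0 ≤ C)
    (hfin : ∀ r, 0 < r → μ (U r) ≠ ⊤)
    (hinc : ∀ r, 0 < r → μ.real (U (r + 1) \ U r) ≤ C * r ^ θ) {r : ℝ} (hr : 0 < r) (n : ℕ) :
    μ.real (U (r + n) \ U r) ≤ n * (C * (r + n) ^ θ) := by
  induction n with
  | zero => simp
  | succ n ih =>
    have hrn : 0 < r + n := by positivity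
    have hsub : U (r + (n + 1 : ℕ)) \ U r ⊆
        (U (r + n + 1) \ U (r + n)) ∪ (U (r + n) \ U r) := by
      intro x hx
      have : r + (n + 1 : ℕ) = r + n + 1 := by push_cast; ring
      rw [this] at hx
      by_cases h : x ∈ U (r + n)
      · exact Or.inr ⟨h, hx.2⟩
      · exact Or.inl ⟨hx.1, h⟩
    have h1 : μ.real (U (r + (n + 1 : ℕ)) \ U r) ≤
        μ.real (U (r + n + 1) \ U (r + n)) + μ.real (U (r + n) \ U r) :=
      (measureReal_mono hsub (measure_union_ne_top
        (measure_ne_top_of_subset Set.sdiff_subset (hfin _ (by positivity)))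
        (measure_ne_top_of_subset Set.sdiff_subset (hfin _ hrn)))).trans
        (measureReal_union_le _ _)
    have hmono : C * (r + n) ^ θ ≤ C * (r + (n + 1 : ℕ)) ^ θ := by
      gcongr; simp
    calc _ ≤ C * (r + n) ^ θ + n * (C * (r + n) ^ θ) := h1.trans (add_le_add (hinc _ hrn) ih)
      _ = (n + 1 : ℕ) * (C * (r + n) ^ θ) := by push_cast; ring
      _ ≤ _ := by gcongr

/-- Lemma 4.11: for `j` in the admissible class `𝒜₁` and a family of bounded open sets
`U R` satisfying the geometric conditions (1.5) with constants `C₀ ≥ 1` and `θ ∈ (0,2)`,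
the number of points in `U R` (times `2π`) matches the area of `U R` up to an error
controlled by the `L^p` norm of `j`, with a constant `C` depending only on `C₀, θ`. -/
theorem stmt10 (C₀ θ : ℝ) (hC₀ : 1 ≤ C₀) (hθ0 : 0 < θ) (hθ2 : θ < 2) :
    ∃ C : ℝ, 0 < C ∧
      ∀ (p : ℝ), 1 < p →
      ∀ (j : E2 → E2), AEStronglyMeasurable j volume →
        LocallyIntegrable j volume →
        (∀ K : Set E2, IsCompact K → IntegrableOn (fun x => ‖j x‖ ^ p) K volume) →
      ∀ (Λ : Set E2), (∀ K : Set E2, IsCompact K → (Λ ∩ K).Finite) →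
        (∃ Cν : ℝ, ∀ R : ℝ, 1 < R →
          2 * Real.pi * ((Λ ∩ ball (0 : E2) R).ncard : ℝ) ≤
            Cν * (volume (ball (0 : E2) R)).toReal) →
        (∀ φ : E2 → ℝ, ContDiff ℝ (⊤ : ℕ∞) φ → HasCompactSupport φ →
          ∫ x, (j x 0 * fderiv ℝ φ x (EuclideanSpace.single 0 1) +
            j x 1 * fderiv ℝ φ x (EuclideanSpace.single 1 1)) = 0) →
        (∀ φ : E2 → ℝ, ContDiff ℝ (⊤ : ℕ∞) φ → HasCompactSupport φ →
          -∫ x, (-(j x 0) * fderiv ℝ φ x (EuclideanSpace.single 1 1) +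
            j x 1 * fderiv ℝ φ x (EuclideanSpace.single 0 1)) =
            2 * Real.pi * (∑' q : Λ, φ q) - ∫ x, φ x) →
      ∀ (U : ℝ → Set E2),
        (∀ R : ℝ, 0 < R → IsOpen (U R) ∧ Bornology.IsBounded (U R)) →
        (∀ R R' : ℝ, 0 < R → R ≤ R' → U R ⊆ U R') →
        (∀ R : ℝ, 0 < R → U R + ball (0 : E2) 1 ⊆ U (R + C₀)) →
        (∀ R : ℝ, 0 < R → U (R + 1) ⊆ U R + ball (0 : E2) C₀) →
        (∀ R : ℝ, 0 < R → (volume (U (R + 1) \ U R)).toReal ≤ C₀ * R ^ θ) →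
      ∀ R : ℝ, C < R →
        |2 * Real.pi * ((Λ ∩ U R).ncard : ℝ) - (volume (U R)).toReal| ≤
          C * (R ^ θ + R ^ (θ * (1 - 1 / p))) *
            ((∫ x in U (R + C), ‖j x‖ ^ p) ^ (1 / p) + 1) ∧
        2 * Real.pi * ((Λ ∩ thickening 1 (U R)).ncard : ℝ) -
            2 * Real.pi * ((Λ ∩ U R).ncard : ℝ) ≤
          C * (R ^ θ + R ^ (θ * (1 - 1 / p))) *
            ((∫ x in U (R + C), ‖j x‖ ^ p) ^ (1 / p) + 1) := by
  obtain ⟨c, hc, hcore⟩ := exists_ncard_sub_volume_le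
  obtain ⟨N, hN⟩ := exists_nat_ge C₀
  have hN1 : (1 : ℝ) ≤ N := hC₀.trans hN
  set K : ℝ := 4 * N * C₀ with hK
  have hK1 : 4 * (N : ℝ) ≤ K := le_mul_of_one_le_right (by positivity) hC₀
  refine ⟨3 * K * (1 + c), by positivity, ?_⟩
  intro p hp j hj _ hjp Λ hΛ _ _ hcurl U hUo hUmono hUadd _ hUvol R hR
  have hRN : 2 * (N : ℝ) < R := by nlinarith
  have hR0 : 0 < R := by linarith
  have hfin (r : ℝ) (hr : 0 < r) : volume (U r) ≠ ⊤ := (hUo r hr).2.measure_lt_top.ne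
  have hthick (r : ℝ) (hr : 0 < r) : thickening 1 (U r) ⊆ U (r + N) := by
    rw [← add_ball_zero]
    exact (hUadd r hr).trans (hUmono _ _ (by linarith) (by linarith))
  set J : ℝ := (∫ x in U (R + 3 * K * (1 + c)), ‖j x‖ ^ p) ^ (1 / p)
  have hJ0 : 0 ≤ J := by positivity
  have hp1 : 1 / p ≤ 1 := by rw [div_le_one (by linarith)]; exact hp.le
  have hp0 : 0 < 1 / p := by positivity
  set b : ℝ := R ^ (θ * (1 - 1 / p))
  have hb0 : 0 ≤ b := by positivity
  have hinc (r : ℝ) (hr : 0 < r) (hrR : r ≤ R + N) :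
      volume.real (U (r + N) \ U r) ≤ K * R ^ θ := by
    have h2 : (2 : ℝ) ^ θ ≤ 4 := by
      calc (2 : ℝ) ^ θ ≤ 2 ^ (2 : ℝ) := Real.rpow_le_rpow_of_exponent_le one_le_two hθ2.le
        _ = 4 := by norm_num
    calc _ ≤ N * (C₀ * (r + N) ^ θ) :=
          measureReal_sdiff_natCast_le hθ0.le (by linarith) hfin hUvol hr N
      _ ≤ N * (C₀ * (2 * R) ^ θ) := by gcongr; linarith
      _ = N * (C₀ * (2 ^ θ * R ^ θ)) := by rw [Real.mul_rpow zero_le_two hR0.le]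
      _ ≤ N * (C₀ * (4 * R ^ θ)) := by gcongr
      _ = _ := by rw [hK]; ring
  have hstep (r : ℝ) (hr : 0 < r) (hrR : r ≤ R + N) :
      2 * Real.pi * ((Λ ∩ U r).ncard : ℝ) - volume.real (U (r + N)) ≤ c * J * (K * b) ∧
      volume.real (U r) - 2 * Real.pi * ((Λ ∩ U (r + N)).ncard : ℝ) ≤ c * J * (K * b) ∧
      volume.real (U (r + N)) ≤ volume.real (U r) + K * R ^ θ := by
    have hrN : 0 < r + N := by positivity
    have hE : c * (∫ x in U (r + N), ‖j x‖ ^ p) ^ (1 / p) *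
        volume.real (U (r + N) \ U r) ^ (1 - 1 / p) ≤ c * J * (K * b) := by
      have hKb : volume.real (U (r + N) \ U r) ^ (1 - 1 / p) ≤ K * b := by
        calc _ ≤ (K * R ^ θ) ^ (1 - 1 / p) :=
              Real.rpow_le_rpow (by positivity) (hinc r hr hrR) (by linarith)
          _ = K ^ (1 - 1 / p) * b := by
              rw [Real.mul_rpow (by positivity) (by positivity), ← Real.rpow_mul hR0.le]
          _ ≤ K * b := by
              gcongr
              exact Real.rpow_le_self_of_one_le (by linarith) (by linarith)
      have hJle : (∫ x in U (r + N), ‖j x‖ ^ p) ^ (1 / p) ≤ J := by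
        have hbig : r + N ≤ R + 3 * K * (1 + c) := by nlinarith
        refine Real.rpow_le_rpow (by positivity) ?_ hp0.le
        refine setIntegral_mono_set ?_ (.of_forall fun x => by positivity)
          (hUmono _ _ hrN hbig).eventuallyLE
        exact (hjp _ (hUo _ (hrN.trans_le hbig)).2.isCompact_closure).mono_set subset_closure
      gcongr
    obtain ⟨h1, h2⟩ := hcore p hp j hj hjp Λ hΛ hcurl (U r) (U (r + N)) (hUo r hr).1
      (hUo _ hrN).1 (hUo _ hrN).2 (hthick r hr)
    refine ⟨h1.trans hE, h2.trans hE, ?_⟩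
    linarith [hinc r hr hrR, le_measureReal_sdiff (μ := volume) (s₁ := U (r + N)) (s₂ := U r)
      (h := hfin r hr)]
  obtain ⟨hm1, hm2, hm3⟩ := hstep (R - N) (by linarith) (by linarith)
  obtain ⟨hr1, hr2, hr3⟩ := hstep R hR0 (by linarith)
  obtain ⟨hp1', hp2', hp3'⟩ := hstep (R + N) (by linarith) le_rfl
  rw [sub_add_cancel] at hm1 hm2 hm3
  have htotal : 3 * (K * R ^ θ + c * J * (K * b)) ≤
      3 * K * (1 + c) * (R ^ θ + b) * (J + 1) := by
    have ha0 : 0 ≤ R ^ θ := by positivity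
    have h0 : 0 ≤ 3 * K * (R ^ θ * J + b * (J + 1) + c * (R ^ θ * (J + 1) + b)) := by positivity
    linear_combination h0
  have ha0 : 0 ≤ K * R ^ θ := by positivity
  have he0 : 0 ≤ c * J * (K * b) := by positivity
  simp only [← measureReal_def]
  refine ⟨abs_le.2 ⟨by linarith, by linarith⟩, ?_⟩
  have hcard : ((Λ ∩ thickening 1 (U R)).ncard : ℝ) ≤ (Λ ∩ U (R + N)).ncard := by
    have hfinN : (Λ ∩ U (R + N)).Finite :=
      (hΛ _ (hUo _ (by linarith)).2.isCompact_closure).subset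
        (Set.inter_subset_inter_right _ subset_closure)
    exact_mod_cast Set.ncard_le_ncard (Set.inter_subset_inter_right _ (hthick R hR0)) hfinN
  have hcard' := mul_le_mul_of_nonneg_left hcard (by positivity : 0 ≤ 2 * Real.pi)
  linarith
end
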